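/- Let n ≥ 1 and let H : ℝ^{2n} → ℝ be a C² convex function that is (0, b∞)-subquadratic at infinity for some constant b∞ > 0. Suppose the set of equilibria {ξ : ∇H(ξ) = 0} is a finite nonempty set {ξ₁, …, ξ_N}; for each k let ω_k be the smallest eigenvalue of the Hessian matrix H''(ξ_k), and set ω := min{ω₁, …, ω_N}; assume ω > b∞ > 0. Then for every T with 2π/ω < T < 2π/b∞, there exists a non-constant C¹ T-periodic solution x̄ : ℝ → ℝ^{2n} of the Hamiltonian system ẋ = J ∇H(x). -/

import Mathlib

open scoped RealInnerProductSpace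
open Real Filter

/-- The standard `2n × 2n` symplectic matrix `J = [[0, Iₙ], [-Iₙ, 0]]`. -/
noncomputable def symplecticJ (n : ℕ) : Matrix (Fin (2*n)) (Fin (2*n)) ℝ :=
  Matrix.reindex (finSumFinEquiv.trans (finCongr (two_mul n).symm))
    (finSumFinEquiv.trans (finCongr (two_mul n).symm))
    (Matrix.fromBlocks 0 1 (-1) 0)

/-- The Hessian matrix of `H : ℝ^m → ℝ` at `ξ`, with entries the second derivatives in the
coordinate directions. -/
noncomputable def hessianMatrix {m : ℕ} (H : EuclideanSpace ℝ (Fin m) → ℝ)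
    (ξ : EuclideanSpace ℝ (Fin m)) : Matrix (Fin m) (Fin m) ℝ :=
  Matrix.of fun i j =>
    iteratedFDeriv ℝ 2 H ξ ![EuclideanSpace.single i 1, EuclideanSpace.single j 1]

set_option linter.unusedSectionVars false

theorem saddle_lemma {X Y : Type*} [NormedAddCommGroup X] [NormedSpace ℝ X]
    [FiniteDimensional ℝ X] [NormedAddCommGroup Y] [NormedSpace ℝ Y] [FiniteDimensional ℝ Y]
    (A : X → Y → ℝ) (hA : Continuous (fun p : X × Y => A p.1 p.2))
    (hy : ∀ r : ℝ, ∃ K : ℝ, ∀ x, ‖x‖ ≤ r → ∀ y, A x 0 ≤ A x y → ‖y‖ ≤ K)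
    (hx : ∀ M : ℝ, ∃ K : ℝ, ∀ x, A x 0 ≤ M → ‖x‖ ≤ K)
    (huniq : ∀ x y₁ y₂, (∀ y, A x y ≤ A x y₁) → (∀ y, A x y ≤ A x y₂) → y₁ = y₂)
    (D : X → Y → X → ℝ)
    (hD : ∀ x y h, HasDerivAt (fun t : ℝ => A (x + t • h) y) (D x y h) 0)
    (hDc : ∀ h, Continuous (fun p : X × Y => D p.1 p.2 h)) :
    ∃ x y, (∀ y', A x y' ≤ A x y) ∧ (∀ x', ∃ y', A x y ≤ A x' y') ∧ ∀ h, D x y h = 0 := by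
  have hmax : ∀ x, ∃ y, ∀ y', A x y' ≤ A x y := by
    intro x
    obtain ⟨K, hK⟩ := hy ‖x‖
    have hc : Continuous (fun y => A x y) := hA.comp (by fun_prop : Continuous fun y => (x, y))
    obtain ⟨y, hyK, hymax⟩ := (isCompact_closedBall (0 : Y) K).exists_isMaxOn
      ⟨0, by simpa using (hK x le_rfl 0 le_rfl)⟩ hc.continuousOn
    refine ⟨y, fun y' => ?_⟩
    by_cases h : A x 0 ≤ A x y'
    · exact hymax (by simpa using hK x le_rfl y' h)
    · have h0 : A x 0 ≤ A x y := hymax (by simpa using (hK x le_rfl 0 le_rfl))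
      linarith
  choose Yf hYf using hmax
  have hlsc : LowerSemicontinuous (fun x => A x (Yf x)) := by
    intro x c hc
    have hcx : Continuous (fun x' => A x' (Yf x)) :=
      hA.comp (by fun_prop : Continuous fun x' => (x', Yf x))
    filter_upwards [hcx.continuousAt.eventually (lt_mem_nhds hc)] with x' hx'
    exact lt_of_lt_of_le hx' (hYf x' _)
  obtain ⟨K, hK⟩ := hx (A 0 (Yf 0))
  have h0K : (0 : X) ∈ Metric.closedBall (0 : X) K := by
    simpa using hK 0 (hYf 0 0)
  obtain ⟨x, hxK, hxmin⟩ := LowerSemicontinuousOn.exists_isMinOn ⟨0, h0K⟩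
    (isCompact_closedBall (0 : X) K) (hlsc.lowerSemicontinuousOn _)
  have hmin : ∀ x', A x (Yf x) ≤ A x' (Yf x') := by
    intro x'
    by_cases h : A x' 0 ≤ A 0 (Yf 0)
    · exact hxmin (by simpa using hK x' h)
    · have h1 : A x (Yf x) ≤ A 0 (Yf 0) := hxmin h0K
      have h2 := hYf x' 0
      linarith
  refine ⟨x, Yf x, hYf x, fun x' => ⟨Yf x', hmin x'⟩, ?_⟩
  have key : ∀ h, 0 ≤ D x (Yf x) h := by
    intro h
    set tn : ℕ → ℝ := fun k => 1 / ((k : ℝ) + 1) with htn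
    have htn0 : Tendsto tn atTop (nhds 0) := tendsto_one_div_add_atTop_nhds_zero_nat
    have htpos : ∀ k, 0 < tn k := fun k => by simp only [htn]; positivity
    have htle : ∀ k, tn k ≤ 1 := fun k => by
      simp only [htn]; rw [div_le_one (by positivity)]; linarith [(Nat.cast_nonneg k : (0:ℝ) ≤ k)]
    obtain ⟨K', hK'⟩ := hy (‖x‖ + ‖h‖)
    have hbd : ∀ k, Yf (x + tn k • h) ∈ Metric.closedBall (0 : Y) K' := by
      intro k
      rw [mem_closedBall_zero_iff]
      refine hK' _ ?_ _ (hYf _ 0)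
      refine (norm_add_le _ _).trans ?_
      rw [norm_smul, Real.norm_of_nonneg (htpos k).le]
      nlinarith [htle k, norm_nonneg h]
    obtain ⟨yb, -, ψ, hψ, hlim⟩ := (isCompact_closedBall (0 : Y) K').tendsto_subseq hbd
    have hxl : Tendsto (fun k => x + tn (ψ k) • h) atTop (nhds x) := by
      have := (htn0.comp hψ.tendsto_atTop).smul_const h
      simpa using this.const_add x
    have hyb : yb = Yf x := by
      apply huniq x _ _ _ (hYf x)
      intro y
      have l1 : Tendsto (fun k => A (x + tn (ψ k) • h) y) atTop (nhds (A x y)) :=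
        (hA.tendsto (x, y)).comp (hxl.prodMk_nhds tendsto_const_nhds)
      have l2 : Tendsto (fun k => A (x + tn (ψ k) • h) (Yf (x + tn (ψ k) • h))) atTop
          (nhds (A x yb)) := (hA.tendsto (x, yb)).comp (hxl.prodMk_nhds hlim)
      exact le_of_tendsto_of_tendsto' l1 l2 (fun k => hYf _ _)
    subst hyb
    have hder : ∀ y t, HasDerivAt (fun t : ℝ => A (x + t • h) y) (D (x + t • h) y h) t := by
      intro y t
      have h1 := hD (x + t • h) y h
      have h2 : HasDerivAt (fun s : ℝ => s - t) 1 t := (hasDerivAt_id t).sub_const t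
      have h3 := HasDerivAt.comp (h₂ := fun s : ℝ => A (x + t • h + s • h) y) (h := fun s : ℝ => s - t)
        t (by simpa using h1) h2
      have h4 : ((fun s : ℝ => A (x + t • h + s • h) y) ∘ fun s : ℝ => s - t)
          = fun s : ℝ => A (x + s • h) y := by
        funext s
        simp only [Function.comp]
        congr 1
        rw [add_assoc, ← add_smul]; congr 2; ring
      rw [h4] at h3
      simpa using h3
    have hs : ∀ k, ∃ s ∈ Set.Ioo 0 (tn k), 0 ≤ D (x + s • h) (Yf (x + tn k • h)) h := by
      intro k
      obtain ⟨s, hs, hseq⟩ := exists_hasDerivAt_eq_slope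
        (fun t : ℝ => A (x + t • h) (Yf (x + tn k • h)))
        (fun t => D (x + t • h) (Yf (x + tn k • h)) h) (htpos k)
        (fun t _ => (hder _ t).continuousAt.continuousWithinAt) (fun t _ => hder _ t)
      refine ⟨s, hs, ?_⟩
      rw [hseq]
      apply div_nonneg _ (by linarith [htpos k])
      have h1 := hmin (x + tn k • h)
      have h2 := hYf x (Yf (x + tn k • h))
      simp only [zero_smul, add_zero]
      linarith
    choose s hs1 hs2 using hs
    have hs0 : Tendsto s atTop (nhds 0) :=
      squeeze_zero (fun k => (hs1 k).1.le) (fun k => (hs1 k).2.le) htn0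
    have hxl' : Tendsto (fun k => x + s (ψ k) • h) atTop (nhds x) := by
      have := (hs0.comp hψ.tendsto_atTop).smul_const h
      simpa using this.const_add x
    have l3 : Tendsto (fun k => D (x + s (ψ k) • h) (Yf (x + tn (ψ k) • h)) h) atTop
        (nhds (D x (Yf x) h)) := ((hDc h).tendsto (x, Yf x)).comp (hxl'.prodMk_nhds hlim)
    exact ge_of_tendsto' l3 (fun k => hs2 _)
  intro h
  refine le_antisymm ?_ (key h)
  have h1 := key (-h)
  have h2 : D x (Yf x) (-h) = - D x (Yf x) h := by
    have e1 := hD x (Yf x) (-h)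
    have e2 := hD x (Yf x) h
    have e3 := HasDerivAt.comp (h₂ := fun s : ℝ => A (x + s • h) (Yf x)) (h := fun s : ℝ => -s)
        0 (by simpa using e2) (hasDerivAt_neg 0)
    have e4 : ((fun s : ℝ => A (x + s • h) (Yf x)) ∘ fun s : ℝ => -s)
          = fun s : ℝ => A (x + s • (-h)) (Yf x) := by
      funext s; simp
    rw [e4] at e3
    simpa using e1.unique e3
  linarith


section Avg
open MeasureTheory

/-- Normalised Lebesgue measure on `[0, T]`. -/
noncomputable def avg (T : ℝ) : Measure ℝ :=
  ENNReal.ofReal T⁻¹ • (volume.restrict (Set.Icc 0 T))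

theorem avg_isProb {T : ℝ} (hT : 0 < T) : IsProbabilityMeasure (avg T) := by
  constructor
  simp only [avg, Measure.smul_apply, smul_eq_mul, Measure.restrict_apply MeasurableSet.univ,
    Set.univ_inter, Real.volume_Icc, sub_zero]
  rw [← ENNReal.ofReal_mul (by positivity), inv_mul_cancel₀ hT.ne', ENNReal.ofReal_one]

theorem integral_avg {F : Type*} [NormedAddCommGroup F] [NormedSpace ℝ F] {T : ℝ} (hT : 0 < T)
    (f : ℝ → F) : ∫ t, f t ∂(avg T) = T⁻¹ • ∫ t in (0:ℝ)..T, f t := by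
  rw [avg, integral_smul_measure, ENNReal.toReal_ofReal (by positivity),
    integral_Icc_eq_integral_Ioc, intervalIntegral.integral_of_le hT.le]

theorem integrable_avg {F : Type*} [NormedAddCommGroup F] {T : ℝ}
    {f : ℝ → F} (hf : Continuous f) : Integrable f (avg T) := by
  refine Integrable.smul_measure ?_ ENNReal.ofReal_ne_top
  exact hf.continuousOn.integrableOn_compact isCompact_Icc

theorem ae_avg {T : ℝ} : ∀ᵐ t ∂(avg T), t ∈ Set.Icc 0 T := by
  refine (Measure.smul_absolutelyContinuous).ae_le ?_
  exact ae_restrict_mem measurableSet_Icc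

theorem continuous_avg {X F : Type*} [TopologicalSpace X] [FirstCountableTopology X]
    [LocallyCompactSpace X] [NormedAddCommGroup F] [NormedSpace ℝ F] {T : ℝ}
    {f : X → ℝ → F} (hf : Continuous f.uncurry) : Continuous (fun x => ∫ t, f x t ∂(avg T)) := by
  simp only [avg, integral_smul_measure]
  exact (continuous_parametric_integral_of_continuous hf isCompact_Icc).const_smul _

variable {E : Type*} [NormedAddCommGroup E] [InnerProductSpace ℝ E] [FiniteDimensional ℝ E]

theorem hasDerivAt_avg {T : ℝ} (hT : 0 < T) {H : E → ℝ} {G : E → E} (hHG : ∀ x, HasGradientAt H (G x) x)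
    (hG : Continuous G) {u v : ℝ → E} (hu : Continuous u) (hv : Continuous v) :
    HasDerivAt (fun s : ℝ => ∫ t, H (u t + s • v t) ∂(avg T)) (∫ t, ⟪G (u t), v t⟫ ∂(avg T)) 0 := by
  have := avg_isProb hT
  have hHc : Continuous H := continuous_iff_continuousAt.2 fun x => (hHG x).continuousAt
  have hc : Continuous (fun p : ℝ × ℝ => ⟪G (u p.2 + p.1 • v p.2), v p.2⟫) := by fun_prop
  obtain ⟨B, hB⟩ := (((isCompact_Icc (a := (-1:ℝ)) (b := 1)).prod
    (isCompact_Icc (a := (0:ℝ)) (b := T))).exists_bound_of_continuousOn hc.continuousOn)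
  have h := hasDerivAt_integral_of_dominated_loc_of_deriv_le (μ := avg T) (x₀ := (0:ℝ))
    (s := Set.Icc (-1) 1) (F := fun s t => H (u t + s • v t))
    (F' := fun s t => ⟪G (u t + s • v t), v t⟫) (bound := fun _ => B)
    (Icc_mem_nhds (by norm_num) (by norm_num))
    (Eventually.of_forall fun s => (integrable_avg (by fun_prop)).aestronglyMeasurable)
    (integrable_avg (by fun_prop))
    (integrable_avg (by fun_prop)).aestronglyMeasurable
    (by
      filter_upwards [ae_avg] with t ht s hs
      exact hB (s, t) ⟨hs, ht⟩)
    (integrable_const B)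
    (by
      refine Eventually.of_forall fun t s _ => ?_
      have h1 := (hHG (u t + s • v t)).hasFDerivAt
      have h2 : HasDerivAt (fun s : ℝ => u t + s • v t) (v t) s := by
        simpa using ((hasDerivAt_id s).smul_const (v t)).const_add (u t)
      have h3 := h1.comp_hasDerivAt s h2
      simpa [Function.comp_def] using h3)
  simpa using h.2

end Avg

section Rot
open MeasureTheory
variable {E : Type*} [NormedAddCommGroup E] [InnerProductSpace ℝ E] [FiniteDimensional ℝ E]

/-- The rotation `exp (θ J)`. -/
noncomputable def rot (J : E →L[ℝ] E) (θ : ℝ) : E →L[ℝ] E :=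
  Real.cos θ • ContinuousLinearMap.id ℝ E + Real.sin θ • J

theorem rot_apply (J : E →L[ℝ] E) (θ : ℝ) (v : E) :
    rot J θ v = Real.cos θ • v + Real.sin θ • J v := by simp [rot]

theorem rot_zero (J : E →L[ℝ] E) (v : E) : rot J 0 v = v := by simp [rot_apply]

theorem rot_rot {J : E →L[ℝ] E} (hJ2 : ∀ x, J (J x) = -x) (θ φ : ℝ) (v : E) :
    rot J θ (rot J φ v) = rot J (θ + φ) v := by
  simp only [rot_apply, map_add, map_smul, hJ2, Real.cos_add, Real.sin_add]
  module

theorem rot_inner {J : E →L[ℝ] E} (hJs : ∀ x y, ⟪J x, y⟫ = -⟪x, J y⟫) (θ : ℝ) (v w : E) :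
    ⟪rot J θ v, w⟫ = ⟪v, rot J (-θ) w⟫ := by
  simp only [rot_apply, inner_add_left, inner_add_right, inner_smul_left, inner_smul_right, hJs,
    Real.cos_neg, Real.sin_neg]
  simp

theorem rot_norm {J : E →L[ℝ] E} (hJ2 : ∀ x, J (J x) = -x) (hJs : ∀ x y, ⟪J x, y⟫ = -⟪x, J y⟫)
    (θ : ℝ) (v : E) : ‖rot J θ v‖ = ‖v‖ := by
  rw [← sq_eq_sq₀ (norm_nonneg _) (norm_nonneg _), ← real_inner_self_eq_norm_sq, rot_inner hJs,
    rot_rot hJ2, neg_add_cancel, rot_zero, real_inner_self_eq_norm_sq]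

@[fun_prop]
theorem rot_continuous {X : Type*} [TopologicalSpace X] (J : E →L[ℝ] E) {θ : X → ℝ} {f : X → E}
    (hθ : Continuous θ) (hf : Continuous f) : Continuous (fun x => rot J (θ x) (f x)) := by
  simp only [rot_apply]; fun_prop

theorem rot_hasDerivAt {J : E →L[ℝ] E} (hJ2 : ∀ x, J (J x) = -x) (c : ℝ) {f : ℝ → E} {f' : E}
    {t : ℝ} (hf : HasDerivAt f f' t) :
    HasDerivAt (fun t => rot J (c * t) (f t))
      (c • J (rot J (c * t) (f t)) + rot J (c * t) f') t := by
  simp only [rot_apply]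
  have h0 : HasDerivAt (fun t : ℝ => c * t) c t := by simpa using (hasDerivAt_id t).const_mul c
  have h1 := (h0.cos.smul hf).add (h0.sin.smul (J.hasFDerivAt.comp_hasDerivAt t hf))
  refine h1.congr_deriv ?_
  simp only [map_add, map_smul, hJ2, Function.comp]
  module

theorem rot_mean_zero {J : E →L[ℝ] E} (hJ2 : ∀ x, J (J x) = -x) {T τ : ℝ} (hT : 0 < T)
    (hτ : τ * T = 2 * π) (k : ℤ) (hk : k ≠ 0) (v : E) :
    ∫ t, rot J (k * τ * t) v ∂(avg T) = 0 := by
  rw [integral_avg hT]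
  have hτ0 : τ ≠ 0 := by
    rintro rfl
    have := Real.pi_pos
    simp at hτ
  have hc : (k : ℝ) * τ ≠ 0 := mul_ne_zero (by exact_mod_cast hk) hτ0
  have hd : ∀ t ∈ Set.uIcc (0:ℝ) T, HasDerivAt (fun t => ((k:ℝ) * τ)⁻¹ • rot J (k * τ * t) (- J v))
      (rot J (k * τ * t) v) t := by
    intro t _
    have h := (rot_hasDerivAt hJ2 (k * τ) (hasDerivAt_const t (-J v))).const_smul ((k:ℝ)*τ)⁻¹
    refine h.congr_deriv ?_
    rw [map_zero, add_zero, smul_smul, inv_mul_cancel₀ hc, one_smul]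
    simp only [rot_apply, map_add, map_smul, map_neg, hJ2]
    module
  rw [intervalIntegral.integral_eq_sub_of_hasDerivAt hd
    ((by fun_prop : Continuous fun t => rot J (k * τ * t) v).intervalIntegrable _ _)]
  have e1 : (k : ℝ) * τ * T = k * (2 * π) := by rw [mul_assoc, hτ]
  have e2 : Real.sin ((k : ℝ) * (2 * π)) = 0 := by
    simpa using Real.sin_add_int_mul_two_pi 0 k
  simp [e1, rot_apply, Real.cos_int_mul_two_pi, e2]

/-- Trigonometric polynomials. -/
noncomputable def trig {ι : Type*} [Fintype ι] (J : E →L[ℝ] E) (τ : ℝ) (κ : ι → ℤ) (a : ι → E) (t : ℝ) : E :=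
  ∑ i, rot J (κ i * τ * t) (a i)

/-- Fourier coefficients. -/
noncomputable def fhat (J : E →L[ℝ] E) (T τ : ℝ) (f : ℝ → E) (k : ℤ) : E :=
  ∫ t, rot J (-(k * τ * t)) (f t) ∂(avg T)

variable {ι : Type*} [Fintype ι]

@[fun_prop]
theorem trig_continuous {X : Type*} [TopologicalSpace X] (J : E →L[ℝ] E) (τ : ℝ) (κ : ι → ℤ)
    {a : X → ι → E} {t : X → ℝ}
    (ha : Continuous a) (ht : Continuous t) : Continuous (fun x => trig J τ κ (a x) (t x)) := by
  unfold trig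
  refine continuous_finsetSum _ fun i _ => ?_
  fun_prop

theorem trig_add (J : E →L[ℝ] E) (τ : ℝ) (κ : ι → ℤ) (a b : ι → E) (t : ℝ) :
    trig J τ κ (a + b) t = trig J τ κ a t + trig J τ κ b t := by
  simp [trig, Finset.sum_add_distrib]

theorem trig_smul (J : E →L[ℝ] E) (τ : ℝ) (κ : ι → ℤ) (c : ℝ) (a : ι → E) (t : ℝ) :
    trig J τ κ (c • a) t = c • trig J τ κ a t := by
  simp [trig, Finset.smul_sum]

theorem trig_fhat {J : E →L[ℝ] E} (hJ2 : ∀ x, J (J x) = -x) {T τ : ℝ} (hT : 0 < T)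
    (hτ : τ * T = 2 * π) {κ : ι → ℤ} (hκ : Function.Injective κ) (a : ι → E) (i : ι) :
    fhat J T τ (trig J τ κ a) (κ i) = a i := by
  classical
  have := avg_isProb hT
  have h1 : ∀ t, rot J (-((κ i : ℤ) * τ * t)) (trig J τ κ a t)
      = ∑ j, rot J ((κ j - κ i : ℤ) * τ * t) (a j) := by
    intro t
    simp only [trig, map_sum]
    refine Finset.sum_congr rfl fun j _ => ?_
    rw [rot_rot hJ2]; congr 2; push_cast; ring
  simp only [fhat, h1]
  rw [integral_finsetSum _ (fun j _ => integrable_avg (by fun_prop)),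
    Finset.sum_eq_single i]
  · simp [rot_zero]
  · intro j _ hj
    exact rot_mean_zero hJ2 hT hτ _ (sub_ne_zero.2 (hκ.ne hj)) _
  · simp

theorem inner_trig {J : E →L[ℝ] E} (hJs : ∀ x y, ⟪J x, y⟫ = -⟪x, J y⟫) {T τ : ℝ} 
    (κ : ι → ℤ) {f : ℝ → E} (hf : Continuous f) (a : ι → E) :
    ∫ t, ⟪f t, trig J τ κ a t⟫ ∂(avg T) = ∑ i, ⟪fhat J T τ f (κ i), a i⟫ := by
  have h1 : ∀ t, ⟪f t, trig J τ κ a t⟫ = ∑ i, ⟪a i, rot J (-(κ i * τ * t)) (f t)⟫ := by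
    intro t
    simp only [trig, inner_sum]
    refine Finset.sum_congr rfl fun i _ => ?_
    rw [real_inner_comm, rot_inner hJs]
  simp only [h1]
  rw [integral_finsetSum _ (fun j _ => integrable_avg (by fun_prop))]
  refine Finset.sum_congr rfl fun i _ => ?_
  rw [fhat, real_inner_comm, integral_inner (integrable_avg (by fun_prop))]

theorem parseval {J : E →L[ℝ] E} (hJ2 : ∀ x, J (J x) = -x) (hJs : ∀ x y, ⟪J x, y⟫ = -⟪x, J y⟫)
    {T τ : ℝ} (hT : 0 < T)
    (hτ : τ * T = 2 * π) {κ : ι → ℤ} (hκ : Function.Injective κ) (a b : ι → E) :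
    ∫ t, ⟪trig J τ κ a t, trig J τ κ b t⟫ ∂(avg T) = ∑ i, ⟪a i, b i⟫ := by
  rw [inner_trig hJs κ (by fun_prop)]
  simp only [trig_fhat hJ2 hT hτ hκ]

theorem parseval_norm {J : E →L[ℝ] E} (hJ2 : ∀ x, J (J x) = -x)
    (hJs : ∀ x y, ⟪J x, y⟫ = -⟪x, J y⟫) {T τ : ℝ} (hT : 0 < T)
    (hτ : τ * T = 2 * π) {κ : ι → ℤ} (hκ : Function.Injective κ) (a : ι → E) :
    ∫ t, ‖trig J τ κ a t‖ ^ 2 ∂(avg T) = ∑ i, ‖a i‖ ^ 2 := by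
  simp only [← real_inner_self_eq_norm_sq]
  exact parseval hJ2 hJs hT hτ hκ a a

theorem trig_hasDerivAt {J : E →L[ℝ] E} (hJ2 : ∀ x, J (J x) = -x) (τ : ℝ) (κ : ι → ℤ) (a : ι → E)
    (t : ℝ) : HasDerivAt (trig J τ κ a)
      (J (trig J τ κ (fun i => ((κ i : ℝ) * τ) • a i) t)) t := by
  have h : ∀ i ∈ Finset.univ, HasDerivAt (fun t => rot J (κ i * τ * t) (a i))
      (J (rot J (κ i * τ * t) (((κ i : ℝ) * τ) • a i))) t := by
    intro i _
    have h := rot_hasDerivAt hJ2 (κ i * τ) (hasDerivAt_const t (a i))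
    refine h.congr_deriv ?_
    simp
  have h2 := HasDerivAt.fun_sum h
  unfold trig
  simpa using h2

theorem trig_periodic (J : E →L[ℝ] E) {T τ : ℝ} 
    (hτ : τ * T = 2 * π) (κ : ι → ℤ) (a : ι → E) (t : ℝ) :
    trig J τ κ a (t + T) = trig J τ κ a t := by
  unfold trig
  refine Finset.sum_congr rfl fun i _ => ?_
  have : (κ i : ℝ) * τ * (t + T) = κ i * τ * t + κ i * (2 * π) := by rw [← hτ]; ring
  rw [this, rot_apply, rot_apply, Real.cos_add_int_mul_two_pi, Real.sin_add_int_mul_two_pi]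

end Rot


section Galerkin
open MeasureTheory
variable {E : Type*} [NormedAddCommGroup E] [InnerProductSpace ℝ E] [FiniteDimensional ℝ E]

/-- The action functional on trigonometric polynomials. -/
noncomputable def act {ι : Type*} [Fintype ι] (J : E →L[ℝ] E) (T τ : ℝ) (H : E → ℝ) (κ : ι → ℤ)
    (lam : ι → ℝ) (a : ι → E) : ℝ :=
  (1/2) * ∑ i, lam i * ‖a i‖ ^ 2 - ∫ t, H (trig J τ κ a t) ∂(avg T)

/-- Its directional derivative. -/
noncomputable def dact {ι : Type*} [Fintype ι] (J : E →L[ℝ] E) (T τ : ℝ) (G : E → E) (κ : ι → ℤ)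
    (lam : ι → ℝ) (a v : ι → E) : ℝ :=
  ∑ i, lam i * ⟪a i, v i⟫ - ∫ t, ⟪G (trig J τ κ a t), trig J τ κ v t⟫ ∂(avg T)

variable {ι : Type*} [Fintype ι]

theorem act_continuous (J : E →L[ℝ] E) (T τ : ℝ) {H : E → ℝ} (hH : Continuous H) (κ : ι → ℤ)
    (lam : ι → ℝ) : Continuous (act J T τ H κ lam) := by
  unfold act
  refine Continuous.sub (by fun_prop) (continuous_avg ?_)
  simp only [Function.uncurry_def]
  fun_prop

theorem dact_continuous (J : E →L[ℝ] E) (T τ : ℝ) {G : E → E} (hG : Continuous G) (κ : ι → ℤ)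
    (lam : ι → ℝ) (v : ι → E) : Continuous (fun a => dact J T τ G κ lam a v) := by
  unfold dact
  refine Continuous.sub (by fun_prop) (continuous_avg ?_)
  simp only [Function.uncurry_def]
  fun_prop

theorem act_hasDerivAt (J : E →L[ℝ] E) {T : ℝ} (hT : 0 < T) (τ : ℝ) {H : E → ℝ} {G : E → E}
    (hHG : ∀ x, HasGradientAt H (G x) x) (hG : Continuous G) (κ : ι → ℤ)
    (lam : ι → ℝ) (a v : ι → E) :
    HasDerivAt (fun s : ℝ => act J T τ H κ lam (a + s • v)) (dact J T τ G κ lam a v) 0 := by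
  unfold act dact
  refine HasDerivAt.sub ?_ ?_
  · have h : ∀ i ∈ Finset.univ, HasDerivAt (fun s : ℝ => lam i * ‖(a + s • v) i‖ ^ 2)
        (lam i * (2 * ⟪a i, v i⟫)) 0 := by
      intro i _
      have h2 : HasDerivAt (fun s : ℝ => (a + s • v) i) (v i) 0 := by
        simpa using ((hasDerivAt_id (0:ℝ)).smul_const (v i)).const_add (a i)
      have h3 := h2.norm_sq.const_mul (lam i)
      simpa using h3
    have h2 := (HasDerivAt.fun_sum h).const_mul (1/2 : ℝ)
    refine h2.congr_deriv ?_
    rw [Finset.mul_sum]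
    refine Finset.sum_congr rfl fun i _ => by ring
  · simp only [trig_add, trig_smul]
    exact hasDerivAt_avg hT hHG hG (by fun_prop) (by fun_prop)

theorem pi_norm_le_of_sum {α : Type*} [Fintype α] (x : α → E) {S : ℝ}
    (h : ∑ i, ‖x i‖ ^ 2 ≤ S) : ‖x‖ ≤ S + 1 := by
  have h0 : 0 ≤ ∑ i, ‖x i‖ ^ 2 := Finset.sum_nonneg fun i _ => by positivity
  rw [pi_norm_le_iff_of_nonneg (by linarith)]
  intro i
  have h1 : ‖x i‖ ^ 2 ≤ ∑ i, ‖x i‖ ^ 2 :=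
    Finset.single_le_sum (f := fun i => ‖x i‖ ^ 2) (fun i _ => by positivity) (Finset.mem_univ i)
  nlinarith [sq_nonneg (‖x i‖ - 1)]

theorem galerkin {α β : Type*} [Fintype α] [Fintype β]
    {J : E →L[ℝ] E} (hJ2 : ∀ x, J (J x) = -x) (hJs : ∀ x y, ⟪J x, y⟫ = -⟪x, J y⟫)
    {T τ : ℝ} (hT : 0 < T) (hτ : τ * T = 2 * π)
    {H : E → ℝ} {G : E → E} (hHG : ∀ x, HasGradientAt H (G x) x) (hG : Continuous G)
    (hconv : ConvexOn ℝ Set.univ H) {b b' c ε ω ρ : ℝ} (hb : 0 < b) (hbb' : b < b')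
    (hup : ∀ x, H x ≤ b / 2 * ‖x‖ ^ 2 + c) (hρ : 0 < ρ) (hε : 0 < ε)
    (hlow : ∀ y, ‖y‖ ≤ ρ → ∀ x, ω * ⟪y, x⟫ - ω / 2 * ‖y‖ ^ 2 ≤ H x)
    {κ : α ⊕ β → ℤ} (hκ : Function.Injective κ) {lam : α ⊕ β → ℝ}
    (hlα : ∀ i, b' ≤ lam (Sum.inl i)) (hlβ : ∀ j, lam (Sum.inr j) ≤ -ε)
    (i₁ : α) (hi₁ : κ (Sum.inl i₁) = 1) (hl₁ : lam (Sum.inl i₁) ≤ τ)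
    (e : E) (he : ‖e‖ = 1) :
    ∃ a : α ⊕ β → E,
      (∀ i, lam i • a i = fhat J T τ (fun t => G (trig J τ κ a t)) (κ i)) ∧
      act J T τ H κ lam a ≤ 1/2 * (τ - ω) * ρ ^ 2 ∧
      1/2 * ∑ i, (lam (Sum.inl i) - b) * ‖a (Sum.inl i)‖ ^ 2 - c ≤ act J T τ H κ lam a := by
  classical
  have := avg_isProb hT
  have hHc : Continuous H := continuous_iff_continuousAt.2 fun x => (hHG x).continuousAt
  have hH0 : ∀ x, 0 ≤ H x := fun x => by simpa using hlow 0 (by simpa using hρ.le) x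
  have hΦ0 : ∀ a : α ⊕ β → E, 0 ≤ ∫ t, H (trig J τ κ a t) ∂(avg T) := fun a =>
    integral_nonneg fun t => hH0 _
  have hΦup : ∀ a : α ⊕ β → E, ∫ t, H (trig J τ κ a t) ∂(avg T) ≤ b / 2 * ∑ i, ‖a i‖ ^ 2 + c := by
    intro a
    rw [← parseval_norm hJ2 hJs hT hτ hκ a]
    calc ∫ t, H (trig J τ κ a t) ∂(avg T)
        ≤ ∫ t, (b / 2 * ‖trig J τ κ a t‖ ^ 2 + c) ∂(avg T) :=
          integral_mono (integrable_avg (by fun_prop)) (integrable_avg (by fun_prop))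
            (fun t => hup _)
      _ = _ := by
          rw [integral_add (integrable_avg (by fun_prop)) (integrable_avg (by fun_prop)),
            integral_const_mul]
          simp
  have helim : Continuous (fun p : (α → E) × (β → E) => (Sum.elim p.1 p.2 : α ⊕ β → E)) := by
    refine continuous_pi fun i => ?_
    cases i <;> simp <;> fun_prop
  -- lower bound at `y = 0`
  have hA0 : ∀ x : α → E, 1/2 * ∑ i, (lam (Sum.inl i) - b) * ‖x i‖ ^ 2 - c
      ≤ act J T τ H κ lam (Sum.elim x 0) := by
    intro x
    have h1 := hΦup (Sum.elim x 0)
    simp only [act, Fintype.sum_sum_type, Sum.elim_inl, Sum.elim_inr, Pi.zero_apply, norm_zero] at h1 ⊢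
    simp only [sub_mul, Finset.sum_sub_distrib, ← Finset.mul_sum]
    simp only [ne_eq, OfNat.ofNat_ne_zero, not_false_eq_true, zero_pow, mul_zero, Finset.sum_const_zero] at h1 ⊢
    linarith
  have hAup : ∀ (x : α → E) (y : β → E), act J T τ H κ lam (Sum.elim x y) ≤
      1/2 * ∑ i, lam (Sum.inl i) * ‖x i‖ ^ 2 - ε / 2 * ∑ j, ‖y j‖ ^ 2
        - ∫ t, H (trig J τ κ (Sum.elim x y) t) ∂(avg T) := by
    intro x y
    simp only [act, Fintype.sum_sum_type, Sum.elim_inl, Sum.elim_inr]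
    have : ∑ j, lam (Sum.inr j) * ‖y j‖ ^ 2 ≤ ∑ j, (-ε) * ‖y j‖ ^ 2 :=
      Finset.sum_le_sum fun j _ => mul_le_mul_of_nonneg_right (hlβ j) (by positivity)
    rw [← Finset.mul_sum] at this
    linarith
  obtain ⟨x, y, hmax, hmin, hD0⟩ := saddle_lemma
    (fun (x : α → E) (y : β → E) => act J T τ H κ lam (Sum.elim x y))
    ((act_continuous J T τ hHc κ lam).comp helim)
    (by
      intro r
      refine ⟨2 / ε * (b / 2 * (Fintype.card α * r ^ 2) + c) + 1, fun x hx y hxy => ?_⟩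
      apply pi_norm_le_of_sum
      have h1 := hA0 x
      have h2 := hAup x y
      have h3 := hΦ0 (Sum.elim x y)
      simp only [sub_mul, Finset.sum_sub_distrib, ← Finset.mul_sum] at h1
      have h4 : ∑ i, ‖x i‖ ^ 2 ≤ Fintype.card α * r ^ 2 := by
        have : ∑ i, ‖x i‖ ^ 2 ≤ ∑ _i : α, r ^ 2 := Finset.sum_le_sum fun i _ =>
          pow_le_pow_left₀ (norm_nonneg _) ((norm_le_pi_norm x i).trans hx) 2
        simpa using this
      have h6 := mul_le_mul_of_nonneg_left h4 hb.le
      have h5 : ε / 2 * ∑ j, ‖y j‖ ^ 2 ≤ b / 2 * (Fintype.card α * r ^ 2) + c := by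
        linarith
      calc ∑ j, ‖y j‖ ^ 2 = 2 / ε * (ε / 2 * ∑ j, ‖y j‖ ^ 2) := by field_simp
        _ ≤ _ := mul_le_mul_of_nonneg_left h5 (by positivity))
    (by
      intro M
      refine ⟨2 / (b' - b) * (M + c) + 1, fun x hx => ?_⟩
      apply pi_norm_le_of_sum
      have h1 := (hA0 x).trans hx
      have h2 : ∑ i, (b' - b) * ‖x i‖ ^ 2 ≤ ∑ i, (lam (Sum.inl i) - b) * ‖x i‖ ^ 2 :=
        Finset.sum_le_sum fun i _ =>
          mul_le_mul_of_nonneg_right (by linarith [hlα i]) (by positivity)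
      rw [← Finset.mul_sum] at h2
      have h3 : 0 < b' - b := by linarith
      calc ∑ j, ‖x j‖ ^ 2 = 2 / (b' - b) * (1 / 2 * ((b' - b) * ∑ j, ‖x j‖ ^ 2)) := by field_simp
        _ ≤ _ := mul_le_mul_of_nonneg_left (by linarith) (by positivity))
    (by
      intro x y₁ y₂ h₁ h₂
      set ym : β → E := (1/2 : ℝ) • y₁ + (1/2 : ℝ) • y₂ with hym
      have hsplit : (Sum.elim x ym : α ⊕ β → E)
          = (1/2 : ℝ) • Sum.elim x y₁ + (1/2 : ℝ) • Sum.elim x y₂ := by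
        funext i
        cases i with
        | inl i => simp [← add_smul]; norm_num
        | inr j => simp [hym]
      have hΦ : ∫ t, H (trig J τ κ (Sum.elim x ym) t) ∂(avg T) ≤
          (1/2) * ∫ t, H (trig J τ κ (Sum.elim x y₁) t) ∂(avg T)
          + (1/2) * ∫ t, H (trig J τ κ (Sum.elim x y₂) t) ∂(avg T) := by
        rw [← integral_const_mul, ← integral_const_mul,
          ← integral_add (integrable_avg (by fun_prop)) (integrable_avg (by fun_prop))]
        refine integral_mono (integrable_avg (by fun_prop)) (integrable_avg (by fun_prop))
          fun t => ?_
        simp only [hsplit, trig_add, trig_smul]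
        exact hconv.2 (Set.mem_univ _) (Set.mem_univ _) (by norm_num) (by norm_num) (by norm_num)
      have hq : ∀ j, ‖ym j‖ ^ 2 = 1/2 * ‖y₁ j‖ ^ 2 + 1/2 * ‖y₂ j‖ ^ 2 - 1/4 * ‖y₁ j - y₂ j‖ ^ 2 := by
        intro j
        simp only [hym, Pi.add_apply, Pi.smul_apply, ← real_inner_self_eq_norm_sq,
          inner_add_left, inner_add_right, inner_sub_left, inner_sub_right, inner_smul_left,
          inner_smul_right, real_inner_comm (y₁ j) (y₂ j)]
        simp
        ring
      have hQ : ∑ j, lam (Sum.inr j) * ‖ym j‖ ^ 2 ≥ 1/2 * ∑ j, lam (Sum.inr j) * ‖y₁ j‖ ^ 2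
          + 1/2 * ∑ j, lam (Sum.inr j) * ‖y₂ j‖ ^ 2 + ε / 4 * ∑ j, ‖y₁ j - y₂ j‖ ^ 2 := by
        simp only [Finset.mul_sum, ← Finset.sum_add_distrib]
        refine Finset.sum_le_sum fun j _ => ?_
        rw [hq j]
        nlinarith [mul_le_mul_of_nonneg_right (hlβ j) (sq_nonneg ‖y₁ j - y₂ j‖)]
      have e1 := h₁ ym
      have e2 := h₂ ym
      simp only [act, Fintype.sum_sum_type, Sum.elim_inl, Sum.elim_inr] at e1 e2
      have hz : ε / 4 * ∑ j, ‖y₁ j - y₂ j‖ ^ 2 ≤ 0 := by linarith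
      have hz' : ∑ j, ‖y₁ j - y₂ j‖ ^ 2 ≤ 0 := by
        by_contra hcon
        push Not at hcon
        have : 0 < ε / 4 * ∑ j, ‖y₁ j - y₂ j‖ ^ 2 := by positivity
        linarith
      funext j
      have h1 : ‖y₁ j - y₂ j‖ ^ 2 ≤ ∑ j, ‖y₁ j - y₂ j‖ ^ 2 :=
        Finset.single_le_sum (f := fun i => ‖y₁ i - y₂ i‖ ^ 2) (fun i _ => by positivity)
          (Finset.mem_univ j)
      have h2 : ‖y₁ j - y₂ j‖ ^ 2 = 0 := le_antisymm (h1.trans hz') (by positivity)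
      exact sub_eq_zero.1 (norm_eq_zero.1 (pow_eq_zero_iff (by norm_num) |>.1 h2)))
    (fun x y h => dact J T τ G κ lam (Sum.elim x y) (Sum.elim h 0))
    (by
      intro x y h
      have h1 := act_hasDerivAt J hT τ hHG hG κ lam (Sum.elim x y) (Sum.elim h 0)
      refine h1.congr_of_eventuallyEq (Eventually.of_forall fun s => ?_)
      simp only
      congr 1
      funext i
      cases i <;> simp)
    (fun h => (dact_continuous J T τ hG κ lam _).comp helim)
  refine ⟨Sum.elim x y, ?_, ?_, ?_⟩
  · have hDy : ∀ h : β → E, dact J T τ G κ lam (Sum.elim x y) (Sum.elim 0 h) = 0 := by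
      intro h
      have h1 := act_hasDerivAt J hT τ hHG hG κ lam (Sum.elim x y) (Sum.elim 0 h)
      refine IsLocalMax.hasDerivAt_eq_zero (Eventually.of_forall fun s => ?_) h1
      have h2 : (Sum.elim x y + s • Sum.elim (0 : α → E) h : α ⊕ β → E) = Sum.elim x (y + s • h) := by
        funext i; cases i <;> simp
      have h3 : (Sum.elim x y + (0 : ℝ) • Sum.elim (0 : α → E) h : α ⊕ β → E) = Sum.elim x y := by simp
      rw [h2, h3]
      exact hmax _
    have hexp : ∀ v : α ⊕ β → E, dact J T τ G κ lam (Sum.elim x y) v =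
        ∑ i, ⟪lam i • (Sum.elim x y : α ⊕ β → E) i
          - fhat J T τ (fun t => G (trig J τ κ (Sum.elim x y) t)) (κ i), v i⟫ := by
      intro v
      rw [dact, inner_trig hJs κ (by fun_prop)]
      simp [inner_sub_left, inner_smul_left]
    set r : α ⊕ β → E := fun i => lam i • (Sum.elim x y : α ⊕ β → E) i
          - fhat J T τ (fun t => G (trig J τ κ (Sum.elim x y) t)) (κ i) with hr
    have hx0 := hD0 (fun i => r (Sum.inl i))
    have hy0 := hDy (fun i => r (Sum.inr i))
    rw [hexp] at hx0 hy0
    have hsum : ∑ i, ⟪r i, r i⟫ = 0 := by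
      simp only [Fintype.sum_sum_type, Sum.elim_inl, Sum.elim_inr, Pi.zero_apply, inner_zero_right,
        Finset.sum_const_zero, add_zero, zero_add] at hx0 hy0 ⊢
      simp only [hr, Sum.elim_inl, Sum.elim_inr] at hx0 hy0 ⊢
      linarith
    intro i
    have h1 := (Finset.sum_eq_zero_iff_of_nonneg (fun i _ => real_inner_self_nonneg)).1 hsum i
      (Finset.mem_univ i)
    exact sub_eq_zero.1 (inner_self_eq_zero.1 h1)
  · obtain ⟨y', hy'⟩ := hmin (Pi.single i₁ (ρ • e))
    refine hy'.trans ?_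
    set a : α ⊕ β → E := Sum.elim (Pi.single i₁ (ρ • e)) y' with ha
    have h2 := hAup (Pi.single i₁ (ρ • e)) y'
    have h3 : ∑ i, lam (Sum.inl i) * ‖(Pi.single i₁ (ρ • e) : α → E) i‖ ^ 2
        = lam (Sum.inl i₁) * ρ ^ 2 := by
      rw [Finset.sum_eq_single i₁]
      · simp [norm_smul, he]
      · intro j _ hj; simp [hj]
      · simp
    have h4 : 0 ≤ ∑ j, ‖y' j‖ ^ 2 := Finset.sum_nonneg fun i _ => by positivity
    have h5 : ω * ρ ^ 2 - ω / 2 * ρ ^ 2 ≤ ∫ t, H (trig J τ κ a t) ∂(avg T) := by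
      set v : ℝ → E := fun t => rot J (((1:ℤ):ℝ) * τ * t) (ρ • e) with hv
      have hvn : ∀ t, ‖v t‖ = ρ := fun t => by
        rw [hv, rot_norm hJ2 hJs, norm_smul, he, mul_one, Real.norm_of_nonneg hρ.le]
      have hvc : Continuous v := by fun_prop
      have hi : ∫ t, ⟪v t, trig J τ κ a t⟫ ∂(avg T) = ρ ^ 2 := by
        have : ∀ t, ⟪v t, trig J τ κ a t⟫
            = ⟪ρ • e, rot J (-((1:ℤ) * τ * t)) (trig J τ κ a t)⟫ := fun t => rot_inner hJs _ _ _
        simp only [this]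
        rw [integral_inner (integrable_avg (by fun_prop))]
        have h6 := trig_fhat hJ2 hT hτ hκ a (Sum.inl i₁)
        rw [hi₁, fhat] at h6
        rw [h6]
        simp [ha, norm_smul, he]
      calc ω * ρ ^ 2 - ω / 2 * ρ ^ 2
          = ∫ t, (ω * ⟪v t, trig J τ κ a t⟫ - ω / 2 * ρ ^ 2) ∂(avg T) := by
            rw [integral_sub (integrable_avg (by fun_prop)) (integrable_avg (by fun_prop)),
              integral_const_mul, hi]
            simp
        _ ≤ _ := by
            refine integral_mono (integrable_avg (by fun_prop)) (integrable_avg (by fun_prop))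
              fun t => ?_
            have := hlow (v t) (hvn t).le (trig J τ κ a t)
            rwa [hvn t] at this
    have h6 : lam (Sum.inl i₁) * ρ ^ 2 ≤ τ * ρ ^ 2 :=
      mul_le_mul_of_nonneg_right hl₁ (by positivity)
    rw [h3] at h2
    have h7 : 0 ≤ ε / 2 * ∑ j, ‖y' j‖ ^ 2 := by positivity
    linarith
  · exact (hA0 x).trans (hmax 0)

end Galerkin


section Bounds
open MeasureTheory
variable {E : Type*} [NormedAddCommGroup E] [InnerProductSpace ℝ E] [FiniteDimensional ℝ E]

theorem grad_growth {H : E → ℝ} {G : E → E}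
    (hgrad : ∀ x z, H x + ⟪G x, z - x⟫ ≤ H z) (hH0 : ∀ x, 0 ≤ H x)
    {b c : ℝ} (hb : 0 < b) (hup : ∀ x, H x ≤ b / 2 * ‖x‖ ^ 2 + c) (hc : 0 ≤ c) (x : E) :
    ‖G x‖ ≤ (2 * b + c) * (1 + ‖x‖) := by
  by_cases h0 : G x = 0
  · rw [h0, norm_zero]; positivity
  have hg : 0 < ‖G x‖ := norm_pos_iff.2 h0
  set z : E := ((1 + ‖x‖) / ‖G x‖) • G x with hz
  have hzn : ‖z‖ = 1 + ‖x‖ := by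
    rw [hz, norm_smul, Real.norm_of_nonneg (by positivity)]; field_simp
  have h1 := hgrad x (x + z)
  have h2 := hup (x + z)
  have h3 := hH0 x
  have h4 : ⟪G x, x + z - x⟫ = (1 + ‖x‖) * ‖G x‖ := by
    rw [add_sub_cancel_left, hz, inner_smul_right, real_inner_self_eq_norm_sq]; field_simp
  have h5 : ‖x + z‖ ≤ 1 + 2 * ‖x‖ := by
    have := norm_add_le x z; rw [hzn] at this; linarith
  have h6 : ‖x + z‖ ^ 2 ≤ (1 + 2 * ‖x‖) ^ 2 := pow_le_pow_left₀ (norm_nonneg _) h5 2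
  rw [h4] at h1
  have hx := norm_nonneg x
  have h7 : (1 + ‖x‖) * ‖G x‖ ≤ (1 + ‖x‖) * ((2 * b + c) * (1 + ‖x‖)) := by
    have h8 : b / 2 * ‖x + z‖ ^ 2 ≤ b / 2 * (1 + 2 * ‖x‖) ^ 2 :=
      mul_le_mul_of_nonneg_left h6 (by positivity)
    have h9 : 0 ≤ b * ‖x‖ := by positivity
    have h10 : 0 ≤ c * ‖x‖ := by positivity
    have h11 : 0 ≤ c * ‖x‖ ^ 2 := by positivity
    nlinarith
  exact le_of_mul_le_mul_left h7 (by positivity)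

theorem path_holder {T C : ℝ} (hT : 0 < T) {u u' : ℝ → E} (hu : ∀ t, HasDerivAt u (u' t) t)
    (hu' : Continuous u') (hC : ∫ t, ‖u' t‖ ^ 2 ∂(avg T) ≤ C) {θ : ℝ} (hθ : 0 < θ)
    {s t : ℝ} (hs : 0 ≤ s) (hst : s ≤ t) (ht : t ≤ T) :
    ‖u t - u s‖ ≤ θ * (T * C) + (t - s) / (2 * θ) := by
  rw [integral_avg hT, smul_eq_mul] at hC
  have hC' : ∫ r in (0:ℝ)..T, ‖u' r‖ ^ 2 ≤ T * C := by
    calc ∫ r in (0:ℝ)..T, ‖u' r‖ ^ 2 = T * (T⁻¹ * ∫ r in (0:ℝ)..T, ‖u' r‖ ^ 2) := by field_simp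
      _ ≤ _ := mul_le_mul_of_nonneg_left hC hT.le
  have hii : ∀ a b, IntervalIntegrable (fun r => ‖u' r‖ ^ 2) volume a b := fun a b =>
    (by fun_prop : Continuous fun r => ‖u' r‖ ^ 2).intervalIntegrable _ _
  have h1 : ∫ r in s..t, ‖u' r‖ ^ 2 ≤ ∫ r in (0:ℝ)..T, ‖u' r‖ ^ 2 :=
    intervalIntegral.integral_mono_interval hs hst ht
      (Eventually.of_forall fun r => by positivity) (hii _ _)
  rw [← intervalIntegral.integral_eq_sub_of_hasDerivAt (fun r _ => hu r)
    (hu'.intervalIntegrable _ _)]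
  have h0 : 0 ≤ ∫ r in s..t, ‖u' r‖ ^ 2 := intervalIntegral.integral_nonneg hst
    fun r _ => by positivity
  calc ‖∫ r in s..t, u' r‖ ≤ ∫ r in s..t, (θ / 2 * ‖u' r‖ ^ 2 + 1 / (2 * θ)) := by
        refine intervalIntegral.norm_integral_le_of_norm_le hst (Eventually.of_forall fun r _ => ?_)
          ((by fun_prop : Continuous fun r => θ / 2 * ‖u' r‖ ^ 2 + 1 / (2 * θ)).intervalIntegrable _ _)
        have : 0 ≤ (θ * ‖u' r‖ - 1) ^ 2 / (2 * θ) := by positivity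
        have e : (θ * ‖u' r‖ - 1) ^ 2 / (2 * θ) = θ / 2 * ‖u' r‖ ^ 2 + 1 / (2 * θ) - ‖u' r‖ := by
          field_simp; ring
        linarith
    _ = θ / 2 * (∫ r in s..t, ‖u' r‖ ^ 2) + (t - s) / (2 * θ) := by
        rw [intervalIntegral.integral_add ((hii _ _).const_mul _) (by simp),
          intervalIntegral.integral_const_mul]
        simp; ring
    _ ≤ _ := by
        have : θ / 2 * (∫ r in s..t, ‖u' r‖ ^ 2) ≤ θ * (T * C) := by nlinarith
        linarith

theorem path_sup {T C M : ℝ} (hT : 0 < T) {u : ℝ → E} (hu : Continuous u)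
    (hM : ‖∫ t, u t ∂(avg T)‖ ≤ M)
    (hC : ∀ s t, 0 ≤ s → s ≤ t → t ≤ T → ‖u t - u s‖ ≤ C) {t : ℝ} (ht0 : 0 ≤ t) (ht : t ≤ T) :
    ‖u t‖ ≤ M + C := by
  have := avg_isProb hT
  have h1 : u t = (∫ s, u s ∂(avg T)) + ∫ s, (u t - u s) ∂(avg T) := by
    rw [integral_sub (integrable_avg (by fun_prop)) (integrable_avg hu)]
    simp
  have h2 : ‖∫ s, (u t - u s) ∂(avg T)‖ ≤ C := by
    have := norm_integral_le_of_norm_le_const (μ := avg T) (f := fun s => u t - u s) (C := C) (by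
      filter_upwards [ae_avg] with s hs
      rcases le_total s t with h | h
      · exact hC s t hs.1 h ht
      · rw [norm_sub_rev]; exact hC t s ht0 h hs.2)
    simpa using this
  rw [h1]
  exact (norm_add_le _ _).trans (add_le_add hM h2)

/-- The frequencies of the approximating trigonometric polynomials. -/
def kap (m : ℕ) : Fin (m + 1) ⊕ Fin (m + 1) → ℤ :=
  Sum.elim (fun i => (i : ℤ) + 1) (fun j => -(j : ℤ))

theorem kap_inj (m : ℕ) : Function.Injective (kap m) := by
  intro i j h
  rcases i with i | i <;> rcases j with j | j <;> simp only [kap, Sum.elim_inl, Sum.elim_inr] at h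
  · congr 1; ext; omega
  · omega
  · omega
  · congr 1; ext; omega

theorem kap_surj (m : ℕ) (k : ℤ) (hk : |k| ≤ m) : ∃ i, kap m i = k := by
  rw [abs_le] at hk
  rcases lt_or_ge 0 k with h | h
  · refine ⟨Sum.inl ⟨(k - 1).toNat, by omega⟩, ?_⟩
    simp only [kap, Sum.elim_inl]; omega
  · refine ⟨Sum.inr ⟨(-k).toNat, by omega⟩, ?_⟩
    simp only [kap, Sum.elim_inr]; omega

set_option maxHeartbeats 2000000 in
theorem approx [Nontrivial E]
    {J : E →L[ℝ] E} (hJ2 : ∀ x, J (J x) = -x) (hJs : ∀ x y, ⟪J x, y⟫ = -⟪x, J y⟫)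
    {T τ : ℝ} (hT : 0 < T) (hτ : τ * T = 2 * π)
    {H : E → ℝ} {G : E → E} (hHG : ∀ x, HasGradientAt H (G x) x) (hG : Continuous G)
    (hconv : ConvexOn ℝ Set.univ H) (hgrad : ∀ x z, H x + ⟪G x, z - x⟫ ≤ H z)
    {b c ω ρ : ℝ} (hb : 0 < b) (hbτ : b < τ) (hωτ : τ < ω) (hc : 0 ≤ c)
    (hup : ∀ x, H x ≤ b / 2 * ‖x‖ ^ 2 + c) (hρ : 0 < ρ)
    (hlow : ∀ y, ‖y‖ ≤ ρ → ∀ x, ω * ⟪y, x⟫ - ω / 2 * ‖y‖ ^ 2 ≤ H x) :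
    ∃ C : ℝ, ∀ ε, 0 < ε → ε ≤ (τ - b) / 2 → ∀ m : ℕ, ∃ u : ℝ → E, Continuous u ∧
      (∀ t, u (t + T) = u t) ∧
      (∀ k : ℤ, |k| ≤ m → (k * τ - ε) • fhat J T τ u k = fhat J T τ (fun t => G (u t)) k) ∧
      (1/2 * ∫ t, ⟪G (u t), u t⟫ ∂(avg T) - ∫ t, H (u t) ∂(avg T) ≤ 1/2 * (τ - ω) * ρ ^ 2) ∧
      (∀ t, 0 ≤ t → t ≤ T → ‖u t‖ ≤ C) ∧
      (∀ θ, 0 < θ → ∀ s t, 0 ≤ s → s ≤ t → t ≤ T → ‖u t - u s‖ ≤ θ * C + (t - s) / (2 * θ)) := by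
  have := avg_isProb hT
  have hHc : Continuous H := continuous_iff_continuousAt.2 fun x => (hHG x).continuousAt
  have hH0 : ∀ x, 0 ≤ H x := fun x => by simpa using hlow 0 (by simpa using hρ.le) x
  set b' := (b + τ) / 2 with hb'
  have hbb' : b < b' := by linarith
  have hb'0 : 0 < b' := by linarith
  have hτ0 : 0 < τ := by linarith
  have hω0 : 0 < ω := by linarith
  set C1 := 2 * c / (1 - b / b') with hC1
  have hr : 0 < 1 - b / b' := by
    rw [sub_pos, div_lt_one hb'0]; exact hbb'
  have hC10 : 0 ≤ C1 := by positivity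
  set C2 := C1 / 2 + c with hC2
  set C3 := (C2 + ω * ρ ^ 2 / 2) / (ω * ρ) with hC3
  have hC30 : 0 ≤ C3 := by positivity
  set C4 := C1 / b' + (C1 + 2 * c) / τ + C3 ^ 2 with hC4
  have hC40 : 0 ≤ C4 := by positivity
  set K := 2 * b + c with hK
  set C5 := 2 * (2 * K ^ 2 * (1 + C4)) + 2 * ((τ - b) / 2) ^ 2 * C4 with hC5
  have hC50 : 0 ≤ C5 := by positivity
  refine ⟨C3 + (T * C5 + T / 2) + T * C5, fun ε hε hε0 m => ?_⟩
  obtain ⟨e, he⟩ := exists_norm_eq E (zero_le_one (α := ℝ))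
  set lam : Fin (m + 1) ⊕ Fin (m + 1) → ℝ := fun i => kap m i * τ - ε with hlam
  have hlα : ∀ i, b' ≤ lam (Sum.inl i) := by
    intro i
    simp only [hlam, kap, Sum.elim_inl]
    push_cast
    have : 0 ≤ ((i : ℕ) : ℝ) * τ := by positivity
    rw [add_mul, one_mul]
    linarith
  obtain ⟨a, ha1, ha2, ha3⟩ := galerkin hJ2 hJs hT hτ hHG hG hconv hb hbb' hup hρ hε hlow
    (kap_inj m) (lam := lam) hlα
    (by
      intro j
      simp only [hlam, kap, Sum.elim_inr]
      push_cast
      have : 0 ≤ ((j : ℕ) : ℝ) * τ := by positivity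
      rw [neg_mul]
      linarith) 0 (by simp [kap]) (by simp [hlam, kap]; linarith) e he
  set κ := kap m with hκ
  have hκi : Function.Injective κ := kap_inj m
  set u : ℝ → E := trig J τ κ a with hu
  have huc : Continuous u := by rw [hu]; fun_prop
  have hcoef : ∀ i, fhat J T τ u (κ i) = a i := fun i => trig_fhat hJ2 hT hτ hκi a i
  -- bounds
  set P := ∑ i, lam (Sum.inl i) * ‖a (Sum.inl i)‖ ^ 2 with hP
  set Q := ∑ j, lam (Sum.inr j) * ‖a (Sum.inr j)‖ ^ 2 with hQ
  set Φ := ∫ t, H (u t) ∂(avg T) with hΦ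
  have hΦ0 : 0 ≤ Φ := integral_nonneg fun t => hH0 _
  have hact : act J T τ H κ lam a = 1/2 * (P + Q) - Φ := by
    simp only [act, Fintype.sum_sum_type, hP, hQ, hΦ, hu]
  have hneg : act J T τ H κ lam a ≤ 0 := by
    have : 1/2 * (τ - ω) * ρ ^ 2 ≤ 0 :=
      mul_nonpos_of_nonpos_of_nonneg (by linarith) (sq_nonneg ρ)
    linarith
  have hPb : (1 - b / b') * P ≤ ∑ i, (lam (Sum.inl i) - b) * ‖a (Sum.inl i)‖ ^ 2 := by
    rw [hP, Finset.mul_sum]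
    refine Finset.sum_le_sum fun i _ => ?_
    rw [← mul_assoc]
    refine mul_le_mul_of_nonneg_right ?_ (by positivity)
    have h1 : b ≤ b / b' * lam (Sum.inl i) := by
      calc b = b / b' * b' := by field_simp
        _ ≤ _ := mul_le_mul_of_nonneg_left (hlα i) (by positivity)
    linarith
  have hP0 : b' * ∑ i, ‖a (Sum.inl i)‖ ^ 2 ≤ P := by
    rw [hP, Finset.mul_sum]
    exact Finset.sum_le_sum fun i _ => mul_le_mul_of_nonneg_right (hlα i) (by positivity)
  have hx0 : 0 ≤ ∑ i, ‖a (Sum.inl i)‖ ^ 2 := Finset.sum_nonneg fun i _ => by positivity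
  have hPn : 0 ≤ P := le_trans (by positivity) hP0
  have hP1 : P ≤ C1 := by
    rw [hC1, le_div_iff₀ hr]; linarith
  have hlowact : -c ≤ act J T τ H κ lam a := by
    have : 0 ≤ (1 - b / b') * P := by positivity
    linarith
  have hQ0 : τ * ∑ j : Fin m, ‖a (Sum.inr j.succ)‖ ^ 2 ≤ -Q := by
    rw [hQ, Fin.sum_univ_succ, Finset.mul_sum, neg_add, ← Finset.sum_neg_distrib]
    have h1 : ∑ j : Fin m, τ * ‖a (Sum.inr j.succ)‖ ^ 2
        ≤ ∑ j : Fin m, -(lam (Sum.inr j.succ) * ‖a (Sum.inr j.succ)‖ ^ 2) := by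
      refine Finset.sum_le_sum fun j _ => ?_
      rw [← neg_mul]
      refine mul_le_mul_of_nonneg_right ?_ (by positivity)
      simp only [hlam, hκ, kap, Sum.elim_inr, Fin.val_succ]
      push_cast
      have : 0 ≤ ((j : ℕ) : ℝ) * τ := by positivity
      rw [neg_mul, add_mul, one_mul]
      linarith
    have h2 : lam (Sum.inr 0) * ‖a (Sum.inr 0)‖ ^ 2 ≤ 0 := by
      apply mul_nonpos_of_nonpos_of_nonneg _ (by positivity)
      simp [hlam, hκ, kap]; linarith
    linarith
  have hy0 : 0 ≤ ∑ j : Fin m, ‖a (Sum.inr j.succ)‖ ^ 2 := Finset.sum_nonneg fun i _ => by positivity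
  have hQn : Q ≤ 0 := by
    have : 0 ≤ τ * ∑ j : Fin m, ‖a (Sum.inr j.succ)‖ ^ 2 := by positivity
    linarith
  have hΦ1 : Φ ≤ C2 := by rw [hC2]; linarith
  have hQ1 : -Q ≤ C1 + 2 * c := by linarith
  have hκ0 : κ (Sum.inr 0) = 0 := by simp [hκ, kap]
  have hmean : ∫ t, u t ∂(avg T) = a (Sum.inr 0) := by
    rw [← hcoef, hκ0]; simp [fhat, rot_zero]
  have ha0 : ‖a (Sum.inr 0)‖ ≤ C3 := by
    set p := a (Sum.inr 0) with hp
    rw [hC3, le_div_iff₀ (by positivity)]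
    by_cases hp0 : p = 0
    · rw [hp0, norm_zero]; simp; positivity
    have hpn : 0 < ‖p‖ := norm_pos_iff.2 hp0
    set y : E := (ρ / ‖p‖) • p with hy
    have hyn : ‖y‖ = ρ := by
      rw [hy, norm_smul, Real.norm_of_nonneg (by positivity)]; field_simp
    have h1 : ∫ t, (ω * ⟪y, u t⟫ - ω / 2 * ρ ^ 2) ∂(avg T) ≤ Φ := by
      refine integral_mono (integrable_avg (by fun_prop)) (integrable_avg (by fun_prop)) fun t => ?_
      have := hlow y hyn.le (u t)
      rwa [hyn] at this
    rw [integral_sub (integrable_avg (by fun_prop)) (integrable_avg (by fun_prop)),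
      integral_const_mul, integral_inner (integrable_avg huc), hmean] at h1
    have h2 : ⟪y, p⟫ = ρ * ‖p‖ := by
      rw [hy, inner_smul_left, real_inner_self_eq_norm_sq]; simp; field_simp
    rw [h2] at h1
    simp at h1
    linarith
  have hS : ∑ i, ‖a i‖ ^ 2 ≤ C4 := by
    rw [Fintype.sum_sum_type, Fin.sum_univ_succ (f := fun j => ‖a (Sum.inr j)‖ ^ 2), hC4]
    have h1 : ∑ i, ‖a (Sum.inl i)‖ ^ 2 ≤ C1 / b' := by
      rw [le_div_iff₀ hb'0]; linarith
    have h2 : ∑ j : Fin m, ‖a (Sum.inr j.succ)‖ ^ 2 ≤ (C1 + 2 * c) / τ := by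
      rw [le_div_iff₀ hτ0]; linarith
    have h3 : ‖a (Sum.inr 0)‖ ^ 2 ≤ C3 ^ 2 := pow_le_pow_left₀ (norm_nonneg _) ha0 2
    linarith
  have hu2 : ∫ t, ‖u t‖ ^ 2 ∂(avg T) = ∑ i, ‖a i‖ ^ 2 := parseval_norm hJ2 hJs hT hτ hκi a
  have hGu : ∫ t, ‖G (u t)‖ ^ 2 ∂(avg T) ≤ 2 * K ^ 2 * (1 + C4) := by
    calc ∫ t, ‖G (u t)‖ ^ 2 ∂(avg T) ≤ ∫ t, (2 * K ^ 2 * (1 + ‖u t‖ ^ 2)) ∂(avg T) := by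
          refine integral_mono (integrable_avg (by fun_prop)) (integrable_avg (by fun_prop))
            fun t => ?_
          have h1 := grad_growth hgrad hH0 hb hup hc (u t)
          have h2 := pow_le_pow_left₀ (norm_nonneg _) h1 2
          refine h2.trans ?_
          rw [mul_pow, ← hK]
          nlinarith [mul_nonneg (sq_nonneg K) (sq_nonneg (1 - ‖u t‖))]
      _ = 2 * K ^ 2 * (1 + ∑ i, ‖a i‖ ^ 2) := by
          rw [integral_const_mul, integral_add (integrable_avg (by fun_prop))
            (integrable_avg (by fun_prop)), hu2]
          simp
      _ ≤ _ := by
          apply mul_le_mul_of_nonneg_left _ (by positivity)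
          linarith
  have hW : ∑ i, ‖lam i • a i‖ ^ 2 ≤ 2 * K ^ 2 * (1 + C4) := by
    have h1 := inner_trig hJs κ (T := T) (τ := τ) (f := fun t => G (u t)) (by fun_prop)
      (fun i => lam i • a i)
    have h2 := parseval_norm hJ2 hJs hT hτ hκi (fun i => lam i • a i)
    simp only [← ha1, real_inner_self_eq_norm_sq] at h1
    have h3 : ∫ t, ⟪G (u t), trig J τ κ (fun i => lam i • a i) t⟫ ∂(avg T) ≤
        ∫ t, (1/2 * ‖G (u t)‖ ^ 2 + 1/2 * ‖trig J τ κ (fun i => lam i • a i) t‖ ^ 2) ∂(avg T) := by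
      refine integral_mono (integrable_avg (by fun_prop)) (integrable_avg (by fun_prop))
        fun t => ?_
      have h4 := real_inner_le_norm (G (u t)) (trig J τ κ (fun i => lam i • a i) t)
      nlinarith [sq_nonneg (‖G (u t)‖ - ‖trig J τ κ (fun i => lam i • a i) t‖)]
    rw [integral_add (integrable_avg (by fun_prop)) (integrable_avg (by fun_prop)),
      integral_const_mul, integral_const_mul, h2, h1] at h3
    linarith
  have hderiv : ∀ t, HasDerivAt u (J (trig J τ κ (fun i => ((κ i : ℝ) * τ) • a i) t)) t :=
    fun t => trig_hasDerivAt hJ2 τ κ a t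
  have hJn : ∀ v, ‖J v‖ = ‖v‖ := by
    intro v
    have := rot_norm hJ2 hJs (π / 2) v
    simpa [rot_apply] using this
  have hu'2 : ∫ t, ‖J (trig J τ κ (fun i => ((κ i : ℝ) * τ) • a i) t)‖ ^ 2 ∂(avg T) ≤ C5 := by
    simp only [hJn]
    rw [parseval_norm hJ2 hJs hT hτ hκi]
    calc ∑ i, ‖((κ i : ℝ) * τ) • a i‖ ^ 2 
        ≤ ∑ i, (2 * ‖lam i • a i‖ ^ 2 + 2 * ((τ - b) / 2) ^ 2 * ‖a i‖ ^ 2) := by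
          refine Finset.sum_le_sum fun i _ => ?_
          have e1 : (κ i : ℝ) * τ = lam i + ε := by simp [hlam]
          rw [e1, norm_smul, norm_smul, mul_pow, mul_pow, Real.norm_eq_abs, Real.norm_eq_abs,
            sq_abs, sq_abs, ← mul_assoc, ← add_mul]
          refine mul_le_mul_of_nonneg_right ?_ (by positivity)
          have e2 : ε ^ 2 ≤ ((τ - b) / 2) ^ 2 := pow_le_pow_left₀ hε.le hε0 2
          nlinarith [sq_nonneg (lam i - ε)]
      _ = 2 * ∑ i, ‖lam i • a i‖ ^ 2 + 2 * ((τ - b) / 2) ^ 2 * ∑ i, ‖a i‖ ^ 2 := by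
          rw [Finset.sum_add_distrib, ← Finset.mul_sum, ← Finset.mul_sum]
      _ ≤ _ := by
          rw [hC5]
          have e3 : 2 * ((τ - b) / 2) ^ 2 * ∑ i, ‖a i‖ ^ 2 ≤ 2 * ((τ - b) / 2) ^ 2 * C4 :=
            mul_le_mul_of_nonneg_left hS (by positivity)
          linarith
  have hhold : ∀ θ, 0 < θ → ∀ s t, 0 ≤ s → s ≤ t → t ≤ T →
      ‖u t - u s‖ ≤ θ * (T * C5) + (t - s) / (2 * θ) := fun θ hθ s t hs hst ht =>
    path_holder hT hderiv (by fun_prop) hu'2 hθ hs hst ht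
  have hTC : 0 ≤ T * C5 := by positivity
  refine ⟨u, huc, trig_periodic J hτ κ a, ?_, ?_, ?_, ?_⟩
  · intro k hk
    obtain ⟨i, rfl⟩ := kap_surj m k hk
    rw [hcoef]
    exact ha1 i
  · have h1 := inner_trig hJs κ (T := T) (τ := τ) (f := fun t => G (u t)) (by fun_prop) a
    simp only [← ha1, inner_smul_left, real_inner_self_eq_norm_sq] at h1
    rw [h1]
    exact ha2
  · intro t ht0 ht
    have h1 := path_sup hT huc (hmean ▸ ha0) (C := T * C5 + T / 2) (fun s t hs hst ht => by
      have := hhold 1 one_pos s t hs hst ht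
      linarith) ht0 ht
    linarith
  · intro θ hθ s t hs hst ht
    have h1 := hhold θ hθ s t hs hst ht
    have h2 : θ * (T * C5) ≤ θ * (C3 + (T * C5 + T / 2) + T * C5) :=
      mul_le_mul_of_nonneg_left (by linarith) hθ.le
    linarith

end Bounds


section Limit
open MeasureTheory
variable {E : Type*} [NormedAddCommGroup E] [InnerProductSpace ℝ E] [FiniteDimensional ℝ E]

theorem fourier_zero_of_coeff {T : ℝ} (hT : 0 < T) {f : ℝ → ℂ} (hf : Continuous f)
    (hper : Function.Periodic f T)
    (h0 : ∀ k : ℤ, ∫ t in (0:ℝ)..T, Complex.exp (-(2 * π * Complex.I * k * t / T)) * f t = 0)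
    (t : ℝ) : f t = 0 := by
  have : Fact (0 < T) := ⟨hT⟩
  have hc : Continuous (hper.lift : AddCircle T → ℂ) := by
    refine (isQuotientMap_quotient_mk'.continuous_iff).2 ?_
    exact hf
  set F : C(AddCircle T, ℂ) := ⟨hper.lift, hc⟩ with hF
  have hFt : ∀ s : ℝ, F (s : AddCircle T) = f s := fun s => hper.lift_coe s
  have hcoeff : fourierCoeff F = 0 := by
    funext k
    rw [fourierCoeff_eq_intervalIntegral _ _ 0, zero_add]
    have : ∀ s : ℝ, fourier (-k) (s : AddCircle T) • F (s : AddCircle T)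
        = Complex.exp (-(2 * π * Complex.I * k * s / T)) * f s := by
      intro s
      rw [hFt, fourier_coe_apply, smul_eq_mul]
      congr 2; push_cast; ring
    simp only [this, h0, smul_zero, Pi.zero_apply]
  have hs := has_pointwise_sum_fourier_series_of_summable (f := F)
    (by rw [hcoeff]; exact summable_zero) (t : AddCircle T)
  rw [hcoeff] at hs
  simp only [Pi.zero_apply, zero_smul] at hs
  have := hs.unique hasSum_zero
  rwa [hFt] at this

theorem zero_of_fhat {J : E →L[ℝ] E} (hJ2 : ∀ x, J (J x) = -x)
    {T τ : ℝ} (hT : 0 < T) (hτ : τ * T = 2 * π) {z : ℝ → E} (hz : Continuous z)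
    (hper : ∀ t, z (t + T) = z t) (h0 : ∀ k : ℤ, fhat J T τ z k = 0) (t : ℝ) : z t = 0 := by
  have key : ∀ e : E, ⟪e, z t⟫ = 0 := by
    intro e
    set l : E →L[ℝ] ℂ := Complex.ofRealCLM.comp (innerSL ℝ e)
      - Complex.I • (Complex.ofRealCLM.comp ((innerSL ℝ e).comp J)) with hl
    have hla : ∀ v, l v = (⟪e, v⟫ : ℂ) - Complex.I * (⟪e, J v⟫ : ℂ) := fun v => by simp [hl]
    have hlrot : ∀ θ v, l (rot J θ v) = Complex.exp (θ * Complex.I) * l v := by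
      intro θ v
      rw [Complex.exp_mul_I, ← Complex.ofReal_cos, ← Complex.ofReal_sin]
      simp only [hla, rot_apply, map_add, map_smul, hJ2, inner_add_right, inner_smul_right,
        inner_neg_right, smul_neg]
      push_cast
      linear_combination (norm := ring_nf) (Complex.sin θ * ⟪e, J v⟫) * Complex.I_sq
      
    have hzero := fourier_zero_of_coeff hT (f := fun s => l (z s)) (by fun_prop)
      (fun s => by simp only [hper]) (fun k => by
        have h1 := congrArg l (h0 k)
        rw [fhat, ← ContinuousLinearMap.integral_comp_comm _ (integrable_avg (by fun_prop)),
          map_zero, integral_avg hT, smul_eq_zero] at h1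
        have h2 := h1.resolve_left (by positivity)
        rw [← h2]
        congr 1
        funext s
        rw [hlrot]
        congr 2
        have hTc : (T : ℂ) ≠ 0 := by exact_mod_cast hT.ne'
        have hτc : (τ : ℂ) * T = 2 * π := by exact_mod_cast hτ
        push_cast
        rw [← hτc]
        field_simp) t
    have := congrArg Complex.re hzero
    simpa [hla] using this
  exact inner_self_eq_zero.1 (key (z t))

theorem ode_of_fhat {J : E →L[ℝ] E} (hJ2 : ∀ x, J (J x) = -x)
    {T τ : ℝ} (hT : 0 < T) (hτ : τ * T = 2 * π) {u g : ℝ → E} (hu : Continuous u)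
    (hg : Continuous g) (hup : ∀ t, u (t + T) = u t) (hgp : ∀ t, g (t + T) = g t)
    (h0 : ∀ k : ℤ, ((k : ℝ) * τ) • fhat J T τ u k = fhat J T τ g k) (t : ℝ) :
    HasDerivAt u (J (g t)) t := by
  have := avg_isProb hT
  have hJg : Continuous fun s => J (g s) := by fun_prop
  set y : ℝ → E := fun t => ∫ s in (0:ℝ)..t, J (g s) with hy
  have hyd : ∀ t, HasDerivAt y (J (g t)) t := fun t =>
    intervalIntegral.integral_hasDerivAt_right (hJg.intervalIntegrable _ _)
      (hJg.stronglyMeasurableAtFilter _ _) hJg.continuousAt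
  have hyc : Continuous y := continuous_iff_continuousAt.2 fun t => (hyd t).continuousAt
  have hτ0 : τ ≠ 0 := by
    rintro rfl
    have := Real.pi_pos
    simp at hτ
  have hyT : ∫ s in (0:ℝ)..T, J (g s) = 0 := by
    have h1 := h0 0
    simp only [Int.cast_zero, zero_mul, zero_smul, fhat, neg_zero, rot_zero] at h1
    have h2 := congrArg J h1
    rw [← ContinuousLinearMap.integral_comp_comm _ (integrable_avg hg), map_zero,
      integral_avg hT] at h2
    exact (smul_eq_zero.1 h2.symm).resolve_left (by positivity)
  have hyp : ∀ t, y (t + T) = y t := by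
    intro t
    have hp : Function.Periodic (fun s => J (g s)) T := fun s => by simp only [hgp]
    have h1 := hp.intervalIntegral_add_eq t 0
    rw [zero_add, hyT] at h1
    simp only [hy]
    rw [← intervalIntegral.integral_add_adjacent_intervals (hJg.intervalIntegrable 0 t)
      (hJg.intervalIntegrable t (t + T)), h1, add_zero]
  have hJinj : ∀ v, J v = 0 → v = 0 := fun v hv => by
    have := hJ2 v
    rw [hv, map_zero] at this
    exact neg_eq_zero.1 this.symm
  have hyk : ∀ k : ℤ, ((k : ℝ) * τ) • fhat J T τ y k = fhat J T τ g k := by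
    intro k
    have hd : ∀ t ∈ Set.uIcc (0:ℝ) T, HasDerivAt (fun t => rot J (-(k * τ) * t) (y t))
        ((-(k * τ) : ℝ) • J (rot J (-(k * τ) * t) (y t)) + rot J (-(k * τ) * t) (J (g t))) t :=
      fun t _ => rot_hasDerivAt hJ2 _ (hyd t)
    have hcomm : ∀ t, (-(k * τ) : ℝ) • J (rot J (-(k * τ) * t) (y t))
        + rot J (-(k * τ) * t) (J (g t))
        = J ((-(k * τ) : ℝ) • rot J (-(k * τ * t)) (y t) + rot J (-(k * τ * t)) (g t)) := by
      intro t
      simp only [rot_apply, map_add, map_smul, neg_mul]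
    have h1 := intervalIntegral.integral_eq_sub_of_hasDerivAt hd
      ((by fun_prop : Continuous fun t => ((-(k * τ) : ℝ) • J (rot J (-(k * τ) * t) (y t))
        + rot J (-(k * τ) * t) (J (g t)))).intervalIntegrable _ _)
    simp only [hcomm] at h1
    have e1 : -((k : ℝ) * τ) * T = (-k : ℤ) * (2 * π) := by push_cast; rw [← hτ]; ring
    have e2 : Real.sin (((-k : ℤ) : ℝ) * (2 * π)) = 0 := by
      simpa using Real.sin_add_int_mul_two_pi 0 (-k)
    have h2 : rot J (-(k * τ) * T) (y T) - rot J (-(k * τ) * 0) (y 0) = 0 := by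
      rw [e1, rot_apply, rot_apply, Real.cos_int_mul_two_pi, e2]
      have := hyp 0
      rw [zero_add] at this
      simp [this]
    rw [h2] at h1
    have h3 : ∫ t, J ((-(k * τ) : ℝ) • rot J (-(k * τ * t)) (y t) + rot J (-(k * τ * t)) (g t))
        ∂(avg T) = 0 := by rw [integral_avg hT, h1, smul_zero]
    rw [ContinuousLinearMap.integral_comp_comm _ (integrable_avg (by fun_prop))] at h3
    have h4 := hJinj _ h3
    rw [integral_add (integrable_avg (by fun_prop)) (integrable_avg (by fun_prop)),
      integral_smul] at h4
    simp only [fhat]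
    rw [neg_smul] at h4
    exact neg_add_eq_zero.1 h4
  set p : E := fhat J T τ u 0 - fhat J T τ y 0 with hp
  have hz : ∀ t, u t - y t - p = 0 := by
    refine zero_of_fhat hJ2 hT hτ (z := fun t => u t - y t - p) (by fun_prop)
      (fun t => by simp only [hup, hyp]) (fun k => ?_)
    have hsplit : fhat J T τ (fun t => u t - y t - p) k
        = fhat J T τ u k - fhat J T τ y k - ∫ t, rot J (-(k * τ * t)) p ∂(avg T) := by
      simp only [fhat, map_sub]
      rw [integral_sub (integrable_avg (by fun_prop)) (integrable_avg (by fun_prop)),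
        integral_sub (integrable_avg (by fun_prop)) (integrable_avg (by fun_prop))]
    rw [hsplit]
    by_cases hk : k = 0
    · subst hk
      simp [rot_zero, hp]
    · have h1 : ∫ t, rot J (-(k * τ * t)) p ∂(avg T) = 0 := by
        have := rot_mean_zero hJ2 hT hτ (-k) (neg_ne_zero.2 hk) p
        rw [← this]
        congr 1; funext t; congr 2; push_cast; ring
      have h2 : fhat J T τ u k = fhat J T τ y k := by
        have h3 := (h0 k).trans (hyk k).symm
        exact smul_right_injective E (mul_ne_zero (by exact_mod_cast hk) hτ0) h3
      rw [h1, h2]; simp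
  have hueq : u = fun t => y t + p := by
    funext t
    have := hz t
    rw [sub_sub, sub_eq_zero] at this
    exact this
  rw [hueq]
  exact (hyd t).add_const p

theorem tendsto_avg {F : Type*} [NormedAddCommGroup F] [NormedSpace ℝ F] {T C : ℝ} (hT : 0 < T)
    {f : ℝ → E → F} (hf : Continuous f.uncurry) {um : ℕ → ℝ → E} {u : ℝ → E}
    (humc : ∀ m, Continuous (um m)) (hC : ∀ m t, 0 ≤ t → t ≤ T → ‖um m t‖ ≤ C)
    (hlim : ∀ t, Tendsto (fun m => um m t) atTop (nhds (u t))) :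
    Tendsto (fun m => ∫ t, f t (um m t) ∂(avg T)) atTop (nhds (∫ t, f t (u t) ∂(avg T))) := by
  have := avg_isProb hT
  obtain ⟨B, hB⟩ := ((isCompact_Icc (a := (0:ℝ)) (b := T)).prod
    (isCompact_closedBall (0 : E) C)).exists_bound_of_continuousOn hf.continuousOn
  refine tendsto_integral_of_dominated_convergence (fun _ => B) ?_ (integrable_const B) ?_ ?_
  · intro m
    exact (integrable_avg (hf.comp (continuous_id.prodMk (humc m)))).aestronglyMeasurable
  · intro m
    filter_upwards [ae_avg] with t ht
    exact hB (t, um m t) ⟨ht, by simpa using hC m t ht.1 ht.2⟩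
  · refine Eventually.of_forall fun t => ?_
    exact (hf.tendsto (t, u t)).comp (tendsto_const_nhds.prodMk_nhds (hlim t))

theorem compactness {T C : ℝ} (hT : 0 < T) {um : ℕ → ℝ → E} 
    (humc : ∀ m, Continuous (um m)) (hper : ∀ m t, um m (t + T) = um m t)
    (hC : ∀ m t, 0 ≤ t → t ≤ T → ‖um m t‖ ≤ C)
    (hH : ∀ m θ, 0 < θ → ∀ s t, 0 ≤ s → s ≤ t → t ≤ T →
      ‖um m t - um m s‖ ≤ θ * C + (t - s) / (2 * θ)) :
    ∃ (ψ : ℕ → ℕ) (u : ℝ → E), StrictMono ψ ∧ Continuous u ∧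
      ∀ t, Tendsto (fun m => um (ψ m) t) atTop (nhds (u t)) := by
  have hC0 : 0 ≤ C := (norm_nonneg _).trans (hC 0 0 le_rfl hT.le)
  set f : ℕ → BoundedContinuousFunction (Set.Icc (0:ℝ) T) E := fun m =>
    BoundedContinuousFunction.mkOfCompact ⟨fun t => um m t, by have := humc m; fun_prop⟩ with hf
  have hfa : ∀ m t, f m t = um m t := fun m t => rfl
  have hcomp : IsCompact (closure (Set.range f)) := by
    refine BoundedContinuousFunction.arzela_ascoli (Metric.closedBall (0 : E) C)
      (isCompact_closedBall _ _) _ ?_ ?_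
    · rintro _ t ⟨m, rfl⟩
      rw [hfa]
      simpa using hC m t t.2.1 t.2.2
    · intro t
      rw [Metric.equicontinuousAt_iff]
      intro ε hε
      set θ := ε / (2 * (C + 1)) with hθ
      have hθ0 : 0 < θ := by positivity
      refine ⟨θ * ε, by positivity, ?_⟩
      rintro s hs ⟨_, m, rfl⟩
      have hs' : |(s : ℝ) - t| < θ * ε := by rwa [Subtype.dist_eq, Real.dist_eq] at hs
      have h1 : θ * C < ε / 2 := by
        have : θ * (C + 1) = ε / 2 := by rw [hθ]; field_simp
        nlinarith
      have h2 : ∀ d, d < θ * ε → d / (2 * θ) ≤ ε / 2 := by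
        intro d hd
        rw [div_le_iff₀ (by positivity)]
        linarith
      change dist (um m t) (um m s) < ε
      rw [abs_lt] at hs'
      rcases le_total (s : ℝ) t with h | h
      · rw [dist_eq_norm]
        have h3 := hH m θ hθ0 s t s.2.1 h t.2.2
        have h4 := h2 (t - s) (by linarith)
        linarith
      · rw [dist_comm, dist_eq_norm]
        have h3 := hH m θ hθ0 t s t.2.1 h s.2.2
        have h4 := h2 (s - t) (by linarith)
        linarith
  obtain ⟨v, -, ψ, hψ, hlim⟩ := hcomp.tendsto_subseq (fun m => subset_closure (Set.mem_range_self m))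
  have hunif := BoundedContinuousFunction.tendsto_iff_tendstoUniformly.1 hlim
  set q : ℝ → Set.Icc (0:ℝ) T := fun t => ⟨toIcoMod hT 0 t, by
    have := toIcoMod_mem_Ico hT 0 t
    exact ⟨this.1, by linarith [this.2]⟩⟩ with hq
  have huq : ∀ m t, um m t = f m (q t) := by
    intro m t
    rw [hfa]
    have hp : Function.Periodic (um m) T := hper m
    simp only [hq]
    rw [← self_sub_toIcoDiv_zsmul, hp.sub_zsmul_eq]
  have hunif2 : TendstoUniformly (fun m t => um (ψ m) t) (fun t => v (q t)) atTop := by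
    have := hunif.comp q
    have e : (fun m t => um (ψ m) t) = fun n => ⇑((f ∘ ψ) n) ∘ q := by
      funext m t
      exact huq _ _
    rw [e]
    exact this
  refine ⟨ψ, fun t => v (q t), hψ, ?_, fun t => hunif2.tendsto_at t⟩
  exact hunif2.continuous (Frequently.of_forall fun m => humc _)

theorem core [Nontrivial E]
    {J : E →L[ℝ] E} (hJ2 : ∀ x, J (J x) = -x) (hJs : ∀ x y, ⟪J x, y⟫ = -⟪x, J y⟫)
    {T τ : ℝ} (hT : 0 < T) (hτ : τ * T = 2 * π)
    {H : E → ℝ} {G : E → E} (hHG : ∀ x, HasGradientAt H (G x) x) (hG : Continuous G)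
    (hconv : ConvexOn ℝ Set.univ H) (hgrad : ∀ x z, H x + ⟪G x, z - x⟫ ≤ H z)
    (hH00 : H 0 = 0)
    {b c ω ρ : ℝ} (hb : 0 < b) (hbτ : b < τ) (hωτ : τ < ω)
    (hup : ∀ x, H x ≤ b / 2 * ‖x‖ ^ 2 + c) (hρ : 0 < ρ)
    (hlow : ∀ y, ‖y‖ ≤ ρ → ∀ x, ω * ⟪y, x⟫ - ω / 2 * ‖y‖ ^ 2 ≤ H x) :
    ∃ u : ℝ → E, (∀ t, HasDerivAt u (J (G (u t))) t) ∧ (∀ t, u (t + T) = u t) ∧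
      ∃ t₁ t₂, u t₁ ≠ u t₂ := by
  have := avg_isProb hT
  have hHc : Continuous H := continuous_iff_continuousAt.2 fun x => (hHG x).continuousAt
  have hH0 : ∀ x, 0 ≤ H x := fun x => by simpa using hlow 0 (by simpa using hρ.le) x
  have hc : 0 ≤ c := by simpa [hH00] using hup 0
  obtain ⟨C, hC⟩ := approx hJ2 hJs hT hτ hHG hG hconv hgrad hb hbτ hωτ hc hup hρ hlow
  set εs : ℕ → ℝ := fun m => (τ - b) / 2 * (1 / ((m : ℝ) + 1)) with hεs
  have hεlim : Tendsto εs atTop (nhds 0) := by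
    have := (tendsto_one_div_add_atTop_nhds_zero_nat (𝕜 := ℝ)).const_mul ((τ - b) / 2)
    rw [mul_zero] at this
    exact this
  have hd : 0 < (τ - b) / 2 := by linarith
  choose um hum1 hum2 hum3 hum4 hum5 hum6 using fun m : ℕ => hC (εs m)
    (by simp only [hεs]; positivity)
    (by
      simp only [hεs]
      apply mul_le_of_le_one_right hd.le
      rw [div_le_one (by positivity)]; linarith [(Nat.cast_nonneg m : (0:ℝ) ≤ m)]) m
  obtain ⟨ψ, u, hψ, huc, hlim⟩ := compactness hT hum1 hum2 hum5 hum6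
  have huper : ∀ t, u (t + T) = u t := fun t =>
    tendsto_nhds_unique (hlim (t + T)) (by simpa only [hum2] using hlim t)
  have hco : ∀ k : ℤ, ((k : ℝ) * τ) • fhat J T τ u k = fhat J T τ (fun t => G (u t)) k := by
    intro k
    have l1 : Tendsto (fun m => fhat J T τ (um (ψ m)) k) atTop (nhds (fhat J T τ u k)) :=
      tendsto_avg hT (f := fun t x => rot J (-(k * τ * t)) x)
        (by simp only [Function.uncurry_def]; fun_prop) (fun m => hum1 _) (fun m => hum5 _) hlim
    have l2 : Tendsto (fun m => fhat J T τ (fun t => G (um (ψ m) t)) k) atTop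
        (nhds (fhat J T τ (fun t => G (u t)) k)) :=
      tendsto_avg hT (f := fun t x => rot J (-(k * τ * t)) (G x))
        (by simp only [Function.uncurry_def]; fun_prop) (fun m => hum1 _) (fun m => hum5 _) hlim
    have l3 : Tendsto (fun m => ((k : ℝ) * τ - εs (ψ m)) • fhat J T τ (um (ψ m)) k) atTop
        (nhds (((k : ℝ) * τ - 0) • fhat J T τ u k)) :=
      ((hεlim.comp hψ.tendsto_atTop).const_sub _).smul l1
    rw [sub_zero] at l3
    refine tendsto_nhds_unique (l3.congr' ?_) l2
    filter_upwards [eventually_ge_atTop k.natAbs] with m hm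
    apply hum3
    have := hψ.id_le m
    simp only [id] at this
    rw [abs_le]
    constructor <;> omega
  have hode := ode_of_fhat hJ2 hT hτ huc (g := fun t => G (u t)) (by fun_prop) huper
    (fun t => by simp only [huper]) hco
  refine ⟨u, hode, huper, ?_⟩
  by_contra hcon
  push Not at hcon
  have hconst : u = fun _ => u 0 := funext fun t => hcon t 0
  have hG0 : G (u 0) = 0 := by
    have h1 := hode 0
    rw [hconst] at h1
    have h2 := h1.unique (hasDerivAt_const (0:ℝ) (u 0))
    have h3 := hJ2 (G (u 0))
    simp only at h2
    rw [h2, map_zero] at h3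
    exact neg_eq_zero.1 h3.symm
  have hHu : H (u 0) = 0 := by
    have h1 := hgrad (u 0) 0
    rw [hG0, inner_zero_left, hH00] at h1
    exact le_antisymm (by linarith) (hH0 _)
  have l1 := tendsto_avg hT (f := fun _ x => ⟪G x, x⟫)
        (by simp only [Function.uncurry_def]; fun_prop) (fun m => hum1 (ψ m)) (fun m => hum5 _) hlim
  have l2 := tendsto_avg hT (f := fun _ x => H x)
        (by simp only [Function.uncurry_def]; fun_prop) (fun m => hum1 (ψ m)) (fun m => hum5 _) hlim
  have l3 := le_of_tendsto' ((l1.const_mul (1/2)).sub l2) (fun m => hum4 (ψ m))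
  rw [hconst] at l3
  simp [hG0, hHu] at l3
  have : (τ - ω) * ρ ^ 2 < 0 := mul_neg_of_neg_of_pos (by linarith) (by positivity)
  linarith

end Limit


section Reduce
variable {E : Type*} [NormedAddCommGroup E] [InnerProductSpace ℝ E] [FiniteDimensional ℝ E]

theorem line_hasDerivAt {H : E → ℝ} {G : E → E} (hHG : ∀ x, HasGradientAt H (G x) x) (x d : E)
    (t : ℝ) : HasDerivAt (fun t : ℝ => H (x + t • d)) ⟪G (x + t • d), d⟫ t := by
  have h1 : HasDerivAt (fun t : ℝ => x + t • d) d t := by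
    simpa using ((hasDerivAt_id t).smul_const d).const_add x
  have h2 := (hHG (x + t • d)).hasFDerivAt.comp_hasDerivAt t h1
  simp only [InnerProductSpace.toDual_apply_apply] at h2
  exact h2

theorem convex_grad {H : E → ℝ} {G : E → E} (hHG : ∀ x, HasGradientAt H (G x) x)
    (hconv : ConvexOn ℝ Set.univ H) (x z : E) : H x + ⟪G x, z - x⟫ ≤ H z := by
  have hc : ConvexOn ℝ Set.univ (fun t : ℝ => H (x + t • (z - x))) := by
    have := hconv.comp_affineMap (AffineMap.lineMap (k := ℝ) x z)
    have e : (fun t : ℝ => H (x + t • (z - x))) = H ∘ (AffineMap.lineMap (k := ℝ) x z) := by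
      funext t
      simp [AffineMap.lineMap_apply, add_comm]
    rw [e]
    simpa using this
  have h1 := hc.le_slope_of_hasDerivAt (Set.mem_univ 0) (Set.mem_univ 1) zero_lt_one
    (line_hasDerivAt hHG x (z - x) 0)
  simp [slope_def_field] at h1
  linarith

theorem lower_quad {H : E → ℝ} {G : E → E} (hHG : ∀ x, HasGradientAt H (G x) x)
    (hconv : ConvexOn ℝ Set.univ H) (hH0 : H 0 = 0) (hG0 : G 0 = 0)
    {L : E →L[ℝ] E} (hL : HasFDerivAt G L 0) {ω ω' : ℝ} (hpos : ∀ x, ω * ‖x‖ ^ 2 ≤ ⟪L x, x⟫)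
    (hω' : 0 < ω') (hωω : ω' < ω) :
    ∃ ρ > 0, ∀ y, ‖y‖ ≤ ρ → ∀ x, ω' * ⟪y, x⟫ - ω' / 2 * ‖y‖ ^ 2 ≤ H x := by
  have h1 := hL.isLittleO
  have h2 := h1.def (sub_pos.2 hωω)
  obtain ⟨δ, hδ, h3⟩ := Metric.eventually_nhds_iff_ball.1 h2
  simp only [hG0, sub_zero] at h3
  have hmono : ∀ x, ‖x‖ < δ → ω' * ‖x‖ ^ 2 ≤ ⟪G x, x⟫ := by
    intro x hx
    have h4 := h3 x (by simpa using hx)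
    have h5 : |⟪G x - L x, x⟫| ≤ ‖G x - L x‖ * ‖x‖ := abs_real_inner_le_norm _ _
    have h6 := (abs_le.1 h5).1
    rw [inner_sub_left] at h6
    have h7 := hpos x
    have h8 := mul_le_mul_of_nonneg_right h4 (norm_nonneg x)
    nlinarith
  have hloc : ∀ x, ‖x‖ < δ → ω' / 2 * ‖x‖ ^ 2 ≤ H x := by
    intro x hx
    have hd : ∀ t : ℝ, HasDerivAt (fun t : ℝ => H (0 + t • x) - ω' / 2 * t ^ 2 * ‖x‖ ^ 2)
        (⟪G (0 + t • x), x⟫ - ω' / 2 * (2 * t) * ‖x‖ ^ 2) t := by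
      intro t
      refine (line_hasDerivAt hHG 0 x t).sub ?_
      have := (((hasDerivAt_id t).pow 2).const_mul (ω' / 2)).mul_const (‖x‖ ^ 2)
      simpa using this
    have hm : MonotoneOn (fun t : ℝ => H (0 + t • x) - ω' / 2 * t ^ 2 * ‖x‖ ^ 2)
        (Set.Icc 0 1) := by
      refine monotoneOn_of_deriv_nonneg (convex_Icc 0 1)
        (fun t _ => (hd t).continuousAt.continuousWithinAt)
        (fun t _ => (hd t).differentiableAt.differentiableWithinAt) (fun t ht => ?_)
      rw [interior_Icc] at ht
      rw [(hd t).deriv, zero_add]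
      have h4 := hmono (t • x) (by
        rw [norm_smul, Real.norm_of_nonneg ht.1.le]
        nlinarith [norm_nonneg x, ht.2])
      rw [inner_smul_right, norm_smul, Real.norm_of_nonneg ht.1.le] at h4
      have h5 : t * (ω' * t * ‖x‖ ^ 2) ≤ t * ⟪G (t • x), x⟫ := by nlinarith
      have h6 := le_of_mul_le_mul_left h5 ht.1
      linarith
    have h4 := hm (Set.left_mem_Icc.2 zero_le_one) (Set.right_mem_Icc.2 zero_le_one) zero_le_one
    simp [hH0] at h4
    linarith
  refine ⟨δ / 4, by positivity, fun y hy x => ?_⟩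
  rcases lt_or_ge ‖x‖ (δ / 2) with hx | hx
  · have h4 := hloc x (by linarith)
    have h5 := sq_nonneg ‖x - y‖
    rw [norm_sub_sq_real, real_inner_comm] at h5
    nlinarith
  · have hx0 : 0 < ‖x‖ := by linarith
    set t := δ / 2 / ‖x‖ with ht
    have ht0 : 0 < t := by positivity
    have ht1 : t ≤ 1 := by rw [ht, div_le_one hx0]; exact hx
    have htx : t * ‖x‖ = δ / 2 := by rw [ht]; field_simp
    have h4 := hloc (t • x) (by rw [norm_smul, Real.norm_of_nonneg ht0.le, htx]; linarith)
    rw [norm_smul, Real.norm_of_nonneg ht0.le] at h4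
    have h5 := hconv.2 (Set.mem_univ x) (Set.mem_univ 0) ht0.le (sub_nonneg.2 ht1) (by ring)
    simp only [smul_zero, add_zero, hH0, smul_eq_mul, mul_zero] at h5
    have h6 : t * (ω' / 2 * (t * ‖x‖) * ‖x‖) ≤ t * H x := by nlinarith
    have h7 := le_of_mul_le_mul_left h6 ht0
    rw [htx] at h7
    have h8 : ⟪y, x⟫ ≤ ‖y‖ * ‖x‖ := real_inner_le_norm y x
    have h9 : ‖y‖ * ‖x‖ ≤ δ / 4 * ‖x‖ := mul_le_mul_of_nonneg_right hy hx0.le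
    have h10 : ω' * ⟪y, x⟫ ≤ ω' * (δ / 4 * ‖x‖) :=
      mul_le_mul_of_nonneg_left (h8.trans h9) hω'.le
    have h11 : 0 ≤ ω' / 2 * ‖y‖ ^ 2 := by positivity
    nlinarith

theorem min_eig [Nontrivial E] {L : E →L[ℝ] E} (hsym : ∀ x y, ⟪L x, y⟫ = ⟪x, L y⟫) :
    ∃ (μ : ℝ) (v : E), v ≠ 0 ∧ L v = μ • v ∧ ∀ x, μ * ‖x‖ ^ 2 ≤ ⟪L x, x⟫ := by
  have hS : (L : E →ₗ[ℝ] E).IsSymmetric := hsym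
  have h1 := hS.hasEigenvalue_iInf_of_finiteDimensional
  obtain ⟨v, hv⟩ := h1.exists_hasEigenvector
  refine ⟨_, v, hv.2, hv.apply_eq_smul, fun x => ?_⟩
  by_cases hx : x = 0
  · simp [hx]
  · have hb : BddBelow (Set.range fun x : { x : E // x ≠ 0 } =>
        RCLike.re ⟪(L : E →ₗ[ℝ] E) x, (x : E)⟫ / ‖(x : E)‖ ^ 2) := by
      refine ⟨-‖L‖, ?_⟩
      rintro _ ⟨z, rfl⟩
      exact (abs_le.1 (L.rayleighQuotient_le_norm (z : E))).1
    have h2 := ciInf_le hb ⟨x, hx⟩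
    have hx0 : 0 < ‖x‖ ^ 2 := by positivity
    rw [le_div_iff₀ hx0] at h2
    exact h2

end Reduce

theorem symplecticJ_transpose (n : ℕ) : (symplecticJ n).transpose = -symplecticJ n := by
  unfold symplecticJ
  rw [Matrix.transpose_reindex, Matrix.fromBlocks_transpose]
  ext i j
  simp only [Matrix.reindex_apply, Matrix.submatrix_apply, Matrix.neg_apply]
  rw [← Matrix.neg_apply, Matrix.fromBlocks_neg]
  simp

theorem symplecticJ_sq (n : ℕ) : symplecticJ n * symplecticJ n = -1 := by
  unfold symplecticJ
  simp only [Matrix.reindex_apply]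
  rw [Matrix.submatrix_mul_equiv, Matrix.fromBlocks_multiply]
  simp
  rw [show Matrix.fromBlocks (-1 : Matrix (Fin n) (Fin n) ℝ) 0 0 (-1 : Matrix (Fin n) (Fin n) ℝ)
    = -1 by rw [← Matrix.fromBlocks_one, Matrix.fromBlocks_neg]; simp]
  ext i j
  simp [Matrix.one_apply]

theorem hessian_lower {m : ℕ} [Nontrivial (EuclideanSpace ℝ (Fin m))]
    {H : EuclideanSpace ℝ (Fin m) → ℝ} (hH2 : ContDiff ℝ 2 H)
    (ξ : EuclideanSpace ℝ (Fin m)) {w : ℝ}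
    (hw : w ∈ lowerBounds
      {μ : ℝ | ∃ v : Fin m → ℝ, v ≠ 0 ∧ (hessianMatrix H ξ).mulVec v = μ • v}) :
    ∃ L : EuclideanSpace ℝ (Fin m) →L[ℝ] EuclideanSpace ℝ (Fin m),
      HasFDerivAt (fun x => gradient H x) L ξ ∧ ∀ x, w * ‖x‖ ^ 2 ≤ ⟪L x, x⟫ := by
  set D := fderiv ℝ (fderiv ℝ H) ξ with hD
  have hdd : HasFDerivAt (fderiv ℝ H) D ξ :=
    ((hH2.fderiv_right (m := 1) (by norm_num)).differentiable (by norm_num) ξ).hasFDerivAt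
  set A : (EuclideanSpace ℝ (Fin m) →L[ℝ] ℝ) →L[ℝ] EuclideanSpace ℝ (Fin m) :=
    LinearMap.toContinuousLinearMap
      { toFun := fun f => (InnerProductSpace.toDual ℝ (EuclideanSpace ℝ (Fin m))).symm f
        map_add' := fun f g => by simp
        map_smul' := fun c f => by simp } with hA
  have hAi : ∀ f x, ⟪A f, x⟫ = f x := fun f x => by
    simp [hA]
  have hsymm : ∀ x y, D x y = D y x := by
    have := (hH2.contDiffAt (x := ξ)).isSymmSndFDerivAt (by simp)
    exact fun x y => this x y
  have hL : HasFDerivAt (fun x => gradient H x) (A.comp D) ξ :=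
    (A.hasFDerivAt (x := fderiv ℝ H ξ)).comp ξ hdd
  obtain ⟨μ, v, hv0, hv, hmin⟩ := min_eig (L := A.comp D) (fun x y => by
    rw [real_inner_comm _ x]
    simp only [ContinuousLinearMap.comp_apply, hAi]
    exact hsymm x y)
  refine ⟨A.comp D, hL, fun x => le_trans ?_ (hmin x)⟩
  refine mul_le_mul_of_nonneg_right (hw ⟨v.ofLp, by simpa using hv0, ?_⟩) (sq_nonneg _)
  funext i
  have h1 : v = ∑ j, v j • EuclideanSpace.single j (1:ℝ) := by
    ext k
    simp [Pi.single_apply]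
  have h2 : ⟪(A.comp D) v, EuclideanSpace.single i (1:ℝ)⟫ = μ * v i := by
    rw [hv, inner_smul_left]
    simp [EuclideanSpace.inner_single_right]
  simp only [ContinuousLinearMap.comp_apply, hAi] at h2
  rw [hsymm] at h2
  simp only [Matrix.mulVec, dotProduct, hessianMatrix, Matrix.of_apply, iteratedFDeriv_two_apply,
    Pi.smul_apply, smul_eq_mul]
  rw [← h2]
  conv_rhs => rw [h1, map_sum]
  refine Finset.sum_congr rfl fun j _ => ?_
  simp [hD, mul_comm]


/-- If `H : ℝ^{2n} → ℝ` is a `C²` convex function, `(0, b∞)`-subquadratic at infinity with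
`b∞ > 0`, with a finite nonempty set of equilibria, `ω` the minimum over the equilibria of the
smallest eigenvalue of the Hessian, and `ω > b∞ > 0`, then for every
`T ∈ (2π/ω, 2π/b∞)` there is a non-constant `C¹` `T`-periodic solution of `ẋ = J ∇H(x)`. -/
theorem nonconstant_periodic_solution_in_period_interval
    (n : ℕ) (hn : 1 ≤ n) (b : ℝ) (hb : 0 < b)
    (H : EuclideanSpace ℝ (Fin (2*n)) → ℝ)
    (hH2 : ContDiff ℝ 2 H)
    (hHconv : ConvexOn ℝ Set.univ H)
    -- `(0, b∞)`-subquadraticity at infinity: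
    (hgrowth : ∃ nf : ℝ → ℝ,
      (∀ x : EuclideanSpace ℝ (Fin (2*n)), nf ‖x‖ ≤ H x) ∧
      Tendsto (fun s => nf s / s) atTop atTop)
    (hupper : ∃ c : ℝ, ∀ x : EuclideanSpace ℝ (Fin (2*n)), H x ≤ b/2 * ‖x‖^2 + c)
    -- the equilibria form a finite nonempty set `s`:
    (s : Finset (EuclideanSpace ℝ (Fin (2*n)))) (hs : s.Nonempty)
    (heq : ∀ ξ : EuclideanSpace ℝ (Fin (2*n)),
      gradient (F := EuclideanSpace ℝ (Fin (2*n))) H ξ = 0 ↔ ξ ∈ s)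
    -- `ωf ξ` is the smallest eigenvalue of the Hessian `H''(ξ)`, and `ω` is their minimum:
    (ωf : EuclideanSpace ℝ (Fin (2*n)) → ℝ)
    (hωf : ∀ ξ ∈ s, IsLeast
      {μ : ℝ | ∃ v : Fin (2*n) → ℝ, v ≠ 0 ∧ (hessianMatrix H ξ).mulVec v = μ • v} (ωf ξ))
    (ω : ℝ) (hω : ω = s.inf' hs ωf)
    (hωb : b < ω) :
    ∀ T : ℝ, 2*π/ω < T → T < 2*π/b →
    ∃ x : ℝ → EuclideanSpace ℝ (Fin (2*n)), ContDiff ℝ 1 x ∧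
      (∀ t, x (t + T) = x t) ∧
      (∀ t, deriv x t =
        (symplecticJ n).mulVec (gradient (F := EuclideanSpace ℝ (Fin (2*n))) H (x t))) ∧
      ∃ t₁ t₂, x t₁ ≠ x t₂ := by

  intro T hT1 hT2
  have hω0 : 0 < ω := hb.trans hωb
  have hπ := Real.pi_pos
  have hT : 0 < T := lt_trans (by positivity) hT1
  have : Nonempty (Fin (2*n)) := ⟨⟨0, by omega⟩⟩
  have : Nontrivial (EuclideanSpace ℝ (Fin (2*n))) := by
    refine ⟨⟨0, EuclideanSpace.single ⟨0, by omega⟩ 1, ?_⟩⟩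
    intro h
    have := congrArg (fun v : EuclideanSpace ℝ (Fin (2*n)) => v ⟨0, by omega⟩) h
    simp at this
  set τ := 2 * π / T with hτd
  have hτ : τ * T = 2 * π := by rw [hτd]; field_simp
  have hbτ : b < τ := by
    rw [hτd, lt_div_iff₀ hT]
    rw [lt_div_iff₀ hb] at hT2
    linarith
  have hτω : τ < ω := by
    rw [hτd, div_lt_iff₀ hT]
    rw [div_lt_iff₀ hω0] at hT1
    linarith
  obtain ⟨ξ, hξ⟩ := hs
  have hGξ := (heq ξ).2 hξ
  have hωξ : ω ≤ ωf ξ := by rw [hω]; exact Finset.inf'_le _ hξ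
  obtain ⟨L, hL, hLpos⟩ := hessian_lower hH2 ξ (hωf ξ hξ).2
  obtain ⟨c, hc⟩ := hupper
  have hgr : ∀ x, HasGradientAt H (gradient H x) x := fun x =>
    (hH2.differentiable (by norm_num) x).hasGradientAt
  have hgc : Continuous (fun x => gradient H x) :=
    (InnerProductSpace.toDual ℝ (EuclideanSpace ℝ (Fin (2*n)))).symm.continuous.comp
      (hH2.continuous_fderiv (by norm_num))
  set H' : EuclideanSpace ℝ (Fin (2*n)) → ℝ := fun x => H (x + ξ) - H ξ with hH'
  set G' : EuclideanSpace ℝ (Fin (2*n)) → EuclideanSpace ℝ (Fin (2*n)) :=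
    fun x => gradient H (x + ξ) with hG'
  have hHG' : ∀ x, HasGradientAt H' (G' x) x := by
    intro x
    have h1 := (hgr (x + ξ)).hasFDerivAt
    have h2 := (h1.comp x ((hasFDerivAt_id x).add_const ξ)).sub_const (H ξ)
    exact h2
  have hG'c : Continuous G' := hgc.comp (continuous_id.add continuous_const)
  have hconv' : ConvexOn ℝ Set.univ H' := by
    have h1 := (hHconv.translate_left ξ).add_const (-H ξ)
    rw [Set.preimage_univ] at h1
    have e : H' = (H ∘ fun z => z + ξ) + fun _ => -H ξ := by
      funext x
      simp [hH', sub_eq_add_neg]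
    rw [e]
    exact h1
  have hL' : HasFDerivAt G' L 0 := by
    have h0 : HasFDerivAt (fun x => gradient H x) L (0 + ξ) := by rwa [zero_add]
    exact h0.comp (0 : EuclideanSpace ℝ (Fin (2*n))) ((hasFDerivAt_id _).add_const ξ)
  obtain ⟨ω', hω'1, hω'2⟩ := exists_between hτω
  obtain ⟨b', hb'1, hb'2⟩ := exists_between hbτ
  obtain ⟨ρ, hρ, hlow⟩ := lower_quad hHG' hconv' (by simp [hH']) (by simp [hG', hGξ]) hL'
    (ω := ω) (ω' := ω')
    (fun x => (mul_le_mul_of_nonneg_right hωξ (sq_nonneg _)).trans (hLpos x)) (by linarith) hω'2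
  have hup : ∀ x, H' x ≤ b' / 2 * ‖x‖ ^ 2
      + (b / 2 * ‖ξ‖ ^ 2 + b ^ 2 * ‖ξ‖ ^ 2 / (2 * (b' - b)) + c - H ξ) := by
    intro x
    have h1 := hc (x + ξ)
    have h2 : ‖x + ξ‖ ^ 2 ≤ (‖x‖ + ‖ξ‖) ^ 2 := by
      gcongr
      exact norm_add_le _ _
    have hd : 0 < b' - b := by linarith
    have h3 : b * ‖x‖ * ‖ξ‖ ≤ (b' - b) / 2 * ‖x‖ ^ 2 + b ^ 2 * ‖ξ‖ ^ 2 / (2 * (b' - b)) := by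
      have e : (b' - b) / 2 * ‖x‖ ^ 2 + b ^ 2 * ‖ξ‖ ^ 2 / (2 * (b' - b)) - b * ‖x‖ * ‖ξ‖
          = ((b' - b) * ‖x‖ - b * ‖ξ‖) ^ 2 / (2 * (b' - b)) := by
        field_simp
        ring
      have : 0 ≤ ((b' - b) * ‖x‖ - b * ‖ξ‖) ^ 2 / (2 * (b' - b)) := by positivity
      linarith
    simp only [hH']
    nlinarith
  set J := Matrix.toEuclideanCLM (n := Fin (2*n)) (𝕜 := ℝ) (symplecticJ n) with hJ
  have hJ2 : ∀ x, J (J x) = -x := by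
    intro x
    have h1 : J * J = -1 := by rw [hJ, ← map_mul, symplecticJ_sq, map_neg, map_one]
    exact congrArg (fun f => f x) h1
  have hJs : ∀ x y, ⟪J x, y⟫ = -⟪x, J y⟫ := by
    have h1 : star J = -J := by
      rw [hJ, ← map_star, Matrix.star_eq_conjTranspose, Matrix.conjTranspose_eq_transpose_of_trivial,
        symplecticJ_transpose, map_neg]
    intro x y
    rw [ContinuousLinearMap.star_eq_adjoint] at h1
    rw [← ContinuousLinearMap.adjoint_inner_right, h1]
    simp
  obtain ⟨u, hu1, hu2, t₁, t₂, hu3⟩ := core hJ2 hJs hT hτ hHG' hG'c hconv'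
    (convex_grad hHG' hconv') (by simp [hH']) (by linarith) hb'2 hω'1 hup hρ hlow
  have hd : ∀ t, HasDerivAt (fun t => u t + ξ) (J (gradient H (u t + ξ))) t := fun t =>
    (hu1 t).add_const ξ
  have huc : Continuous u := continuous_iff_continuousAt.2 fun t => (hu1 t).continuousAt
  refine ⟨fun t => u t + ξ, ?_, fun t => by simp only [hu2], fun t => ?_, t₁, t₂, fun h => hu3 (add_right_cancel h)⟩
  · rw [contDiff_one_iff_deriv]
    refine ⟨fun t => (hd t).differentiableAt, ?_⟩
    have : deriv (fun t => u t + ξ) = fun t => J (gradient H (u t + ξ)) :=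
      funext fun t => (hd t).deriv
    rw [this]
    exact J.continuous.comp (hgc.comp (huc.add continuous_const))
  · rw [(hd t).deriv]
    rfl
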